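/- The group G₂₂ = ⟨x,y | x² = y³ = ((xy)⁴(xy²)³(xy)²(xy²)³xy(xy²)²)² = 1⟩ contains a subgroup isomorphic to the free group of rank 2. -/

import Mathlib

/-- The free product `ℤ/2 * ℤ/3` is realised as a quotient of the free group on two
generators; here we work with the free group `F` on generators `x, y` and impose the
relations `x² = y³ = W² = 1` all at once via `PresentedGroup`. -/
abbrev F : Type := FreeGroup (Fin 2)

/-- The generator `x` (of order 2 in the quotient). -/
def x : F := FreeGroup.of 0

/-- The generator `y` (of order 3 in the quotient). -/
def y : F := FreeGroup.of 1

/-- The relators of the generalised triangle group of type (2,3,2) with word `W`. -/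
def rels (W : F) : Set F := {x ^ 2, y ^ 3, W ^ 2}

/-- The generalised triangle group `⟨x, y | x² = y³ = W² = 1⟩`. -/
abbrev GT (W : F) : Type := PresentedGroup (rels W)

/-- The canonical projection from the free group to the generalised triangle group. -/
def mk (W : F) : F →* GT W := PresentedGroup.mk (rels W)

/-- The word `(xy)⁴(xy²)³(xy)²(xy²)³xy(xy²)²` defining `G₂₂`. -/
def W22 : F := (x*y)^4 * (x*y^2)^3 * (x*y)^2 * (x*y^2)^3 * (x*y) * (x*y^2)^2

section

open Equiv

/-- The number of classes of the equivalence relation generated by `r`. -/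
noncomputable def classCount {D : Type} (r : D → D → Prop) : ℕ := Nat.card (Quot r)

/-- The relation `r` together with the additional pair `(u, v)`. -/
def linkRel {D : Type} (r : D → D → Prop) (u v : D) : D → D → Prop :=
  fun a b => r a b ∨ (a = u ∧ b = v)

section Count
variable {D : Type} [Finite D]

theorem classCount_mono {r s : D → D → Prop} (h : ∀ a b, r a b → Relation.EqvGen s a b) :
    classCount s ≤ classCount r := by
  refine Nat.card_le_card_of_surjective
    (Quot.lift (fun a => Quot.mk s a) fun a b hab => Quot.eqvGen_sound (h a b hab)) ?_
  rintro ⟨a⟩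
  exact ⟨Quot.mk r a, rfl⟩

theorem classCount_congr {r s : D → D → Prop} (h : ∀ a b, r a b → Relation.EqvGen s a b)
    (h' : ∀ a b, s a b → Relation.EqvGen r a b) : classCount s = classCount r :=
  le_antisymm (classCount_mono h) (classCount_mono h')

theorem classCount_le_link (r : D → D → Prop) (u v : D) :
    classCount r ≤ classCount (linkRel r u v) + 1 := by
  classical
  let g : Quot (linkRel r u v) → Quot r := Quot.lift
    (fun a => if Quot.mk r a = Quot.mk r u then Quot.mk r v else Quot.mk r a) (by
      rintro a b (h | ⟨rfl, rfl⟩)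
      · simp only [Quot.sound h]
      · simp)
  have hle : classCount r ≤ Nat.card (Option (Quot (linkRel r u v))) := by
    refine Nat.card_le_card_of_surjective (fun o => o.elim (Quot.mk r u) g) ?_
    rintro ⟨a⟩
    by_cases h : Quot.mk r a = Quot.mk r u
    · exact ⟨none, h.symm⟩
    · exact ⟨some (Quot.mk _ a), if_neg h⟩
  rwa [Finite.card_option] at hle

theorem classCount_link_lt {r : D → D → Prop} {u v : D} (h : ¬ Relation.EqvGen r u v) :
    classCount (linkRel r u v) + 1 ≤ classCount r := by
  classical
  let g : Quot r → Quot (linkRel r u v) :=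
    Quot.lift (fun a => Quot.mk _ a) fun a b hab => Quot.sound (Or.inl hab)
  have hs : Function.Surjective (fun c : {c : Quot r // c ≠ Quot.mk r u} => g c.1) := by
    rintro ⟨a⟩
    by_cases ha : Quot.mk r a = Quot.mk r u
    · refine ⟨⟨Quot.mk r v, fun e => h (Quot.eqvGen_exact e.symm)⟩, ?_⟩
      have h1 : Quot.mk (linkRel r u v) a = Quot.mk (linkRel r u v) u := congrArg g ha
      have h2 : Quot.mk (linkRel r u v) u = Quot.mk (linkRel r u v) v :=
        Quot.sound (Or.inr ⟨rfl, rfl⟩)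
      exact (h1.trans h2).symm
    · exact ⟨⟨Quot.mk r a, ha⟩, rfl⟩
  have h1 := Nat.card_le_card_of_surjective _ hs
  have h2 : Nat.card {c : Quot r // c ≠ Quot.mk r u} < Nat.card (Quot r) :=
    Finite.card_subtype_lt (x := Quot.mk r u) (by simp)
  exact Nat.lt_of_le_of_lt h1 h2

theorem classCount_le_link_of_eqvGen {r : D → D → Prop} {u v : D} (h : Relation.EqvGen r u v) :
    classCount r ≤ classCount (linkRel r u v) := by
  refine classCount_mono ?_
  rintro a b (hab | ⟨rfl, rfl⟩)
  · exact .rel _ _ hab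
  · exact h

end Count

/-- The number of cycles of a permutation, fixed points included. -/
noncomputable def cycleCount {D : Type} (σ : Perm D) : ℕ := classCount fun a b => σ a = b

theorem eqvGen_perm_iff {D : Type} (σ : Perm D) (a b : D) :
    Relation.EqvGen (fun a b => σ a = b) a b ↔ σ.SameCycle a b := by
  constructor
  · intro h
    induction h with
    | rel a b h => exact h ▸ (Perm.sameCycle_apply_right.2 (Perm.SameCycle.refl σ a))
    | refl a => exact Perm.SameCycle.refl σ a
    | symm a b _ h => exact h.symm
    | trans a b c _ _ h1 h2 => exact h1.trans h2
  · rintro ⟨n, rfl⟩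
    have hn : ∀ (n : ℕ) (a : D), Relation.EqvGen (fun a b => σ a = b) a ((σ ^ n) a) := by
      intro n
      induction n with
      | zero => intro a; exact .refl _
      | succ n ih =>
        intro a
        rw [pow_succ', Perm.mul_apply]
        exact (ih a).trans _ _ _ (.rel _ _ rfl)
    rcases n with n | n
    · simpa using hn n a
    · have := hn (n + 1) ((σ ^ (Int.negSucc n)) a)
      rw [← Perm.mul_apply, zpow_negSucc, mul_inv_cancel] at this
      exact this.symm

section Swap
variable {D : Type} [Finite D] [DecidableEq D]

omit [DecidableEq D] in
theorem sameCycle_mem_of_forall {σ : Perm D} {B : Set D} (hB : ∀ d ∈ B, σ d ∈ B) {a b : D}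
    (h : σ.SameCycle a b) (ha : a ∈ B) : b ∈ B := by
  obtain ⟨n, -, -, rfl⟩ := h.exists_pow_eq''
  clear h
  induction n with
  | zero => exact ha
  | succ n ih => rw [pow_succ', Perm.mul_apply]; exact hB _ ih

theorem sameCycle_mul_swap_of_not {σ : Perm D} {u v : D} (h : ¬ σ.SameCycle u v) :
    (σ * swap u v).SameCycle u v := by
  by_contra hc
  have hmem := sameCycle_mem_of_forall (σ := σ)
    (B := {d | σ.SameCycle v d ∧ (σ * swap u v).SameCycle u d}) (a := σ v) (b := v) ?_
    ?_ ?_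
  · exact hc hmem.2
  · rintro d ⟨h1, h2⟩
    refine ⟨Perm.sameCycle_apply_right.2 h1, ?_⟩
    have hdu : d ≠ u := by rintro rfl; exact h h1.symm
    have hdv : d ≠ v := by rintro rfl; exact hc h2
    have := Perm.sameCycle_apply_right.2 h2
    rwa [Perm.mul_apply, swap_apply_of_ne_of_ne hdu hdv] at this
  · exact Perm.sameCycle_apply_left.2 (Perm.SameCycle.refl _ _)
  · refine ⟨Perm.sameCycle_apply_right.2 (Perm.SameCycle.refl _ _), ?_⟩
    have := Perm.sameCycle_apply_right.2 (Perm.SameCycle.refl (σ * swap u v) u)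
    rwa [Perm.mul_apply, swap_apply_left] at this

theorem not_sameCycle_mul_swap {σ : Perm D} {u v : D} (h : σ.SameCycle u v) (huv : u ≠ v) :
    ¬ (σ * swap u v).SameCycle u v := by
  classical
  intro hc
  have hex : ∃ n : ℕ, (σ ^ n) u = v := by
    obtain ⟨n, -, -, hn⟩ := h.exists_pow_eq''
    exact ⟨n, hn⟩
  set n := Nat.find hex with hn
  have hnv : (σ ^ n) u = v := Nat.find_spec hex
  have hmin : ∀ m < n, (σ ^ m) u ≠ v := fun m hm => Nat.find_min hex hm
  have hn0 : n ≠ 0 := by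
    intro h0
    rw [h0] at hnv
    exact huv hnv
  have hu : ∀ j, 0 < j → j ≤ n → (σ ^ j) u ≠ u := by
    intro j hj hjn hju
    refine hmin (n - j) (by omega) ?_
    rw [← hnv]
    conv_rhs => rw [← Nat.sub_add_cancel hjn, pow_add, Perm.mul_apply, hju]
  have hmem := sameCycle_mem_of_forall (σ := σ * swap u v)
    (B := {d | ∃ j, 0 < j ∧ j ≤ n ∧ (σ ^ j) u = d}) (a := v) (b := u) ?_ hc.symm
    ⟨n, by omega, le_rfl, hnv⟩
  · obtain ⟨j, h0, h1, h2⟩ := hmem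
    exact hu j h0 h1 h2
  · rintro d ⟨j, h0, h1, rfl⟩
    rcases h1.lt_or_eq with h1 | rfl
    · refine ⟨j + 1, by omega, h1, ?_⟩
      rw [Perm.mul_apply, swap_apply_of_ne_of_ne (hu j h0 h1.le) (hmin j h1), pow_succ',
        Perm.mul_apply]
    · refine ⟨1, by omega, by omega, ?_⟩
      rw [hnv, Perm.mul_apply, swap_apply_right, pow_one]

omit [Finite D] in
theorem eqvGen_link_of_mul_swap {σ : Perm D} {s : D → D → Prop} {u v : D}
    (h : ∀ a b, σ a = b → s a b) (a b : D)
    (hab : (σ * swap u v) a = b) : Relation.EqvGen (linkRel s u v) a b := by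
  subst hab
  rw [Perm.mul_apply]
  by_cases hu : a = u
  · subst hu
    rw [swap_apply_left]
    exact .trans _ _ _ (.rel _ _ (Or.inr ⟨rfl, rfl⟩)) (.rel _ _ (Or.inl (h _ _ rfl)))
  by_cases hv : a = v
  · subst hv
    rw [swap_apply_right]
    exact .trans _ _ _ (.symm _ _ (.rel _ _ (Or.inr ⟨rfl, rfl⟩))) (.rel _ _ (Or.inl (h _ _ rfl)))
  · rw [swap_apply_of_ne_of_ne hu hv]
    exact .rel _ _ (Or.inl (h _ _ rfl))

end Swap

/-- The number of connected components of the hypermap with face permutation `φ` and vertex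
permutation `α`. -/
noncomputable def componentCount {D : Type} (φ α : Perm D) : ℕ :=
  classCount fun a b => φ a = b ∨ α a = b

/-- The hypermap with face permutation `φ` and vertex permutations `α` and `α * φ` has Euler
characteristic at least twice its number of components. -/
def IsPlanar {D : Type} (φ α : Perm D) : Prop :=
  Nat.card D + 2 * componentCount φ α ≤ cycleCount φ + cycleCount α + cycleCount (α * φ)

section Planar
variable {D : Type}

theorem eqvGen_bind {r s : D → D → Prop} (h : ∀ a b, r a b → Relation.EqvGen s a b) {a b : D}
    (hab : Relation.EqvGen r a b) : Relation.EqvGen s a b := by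
  induction hab with
  | rel a b hr => exact h a b hr
  | refl a => exact .refl a
  | symm a b _ ih => exact .symm _ _ ih
  | trans a b c _ _ ih1 ih2 => exact .trans _ _ _ ih1 ih2

theorem eq_of_eqvGen_of_isolated {r : D → D → Prop} {p q : D}
    (h : ∀ a b, r a b → (a = p ↔ b = p)) (hpq : Relation.EqvGen r p q) : q = p := by
  have key : ∀ a b, Relation.EqvGen r a b → (a = p ↔ b = p) := by
    intro a b hab
    induction hab with
    | rel a b hr => exact h a b hr
    | refl a => exact Iff.rfl
    | symm a b _ ih => exact ih.symm
    | trans a b c _ _ ih1 ih2 => exact ih1.trans ih2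
  exact (key p q hpq).1 rfl

theorem eqvGen_alpha_beta (φ α : Perm D) (a b : D)
    (h : φ a = b) : Relation.EqvGen (fun a b => α a = b ∨ (α * φ) a = b) a b := by
  subst h
  exact .trans _ (α (φ a)) _ (.rel _ _ (Or.inr rfl)) (.symm _ _ (.rel _ _ (Or.inl rfl)))

theorem componentCount_eq_alpha [Finite D] (φ α : Perm D) :
    componentCount φ α = classCount fun a b => α a = b ∨ (α * φ) a = b := by
  refine classCount_congr ?_ ?_
  · rintro a _ (rfl | rfl)
    · exact .rel _ _ (Or.inr rfl)
    · exact .trans _ (φ a) _ (.rel _ _ (Or.inl rfl)) (.rel _ _ (Or.inr rfl))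
  · rintro a _ (rfl | rfl)
    · exact eqvGen_alpha_beta φ α _ _ rfl
    · exact .rel _ _ (Or.inl rfl)

section Ops
variable [Finite D] [DecidableEq D]

omit [Finite D] in
theorem eqvGen_link_or_mul_swap (r : D → D → Prop) (σ : Perm D) (u v a b : D)
    (h : linkRel (fun a b => r a b ∨ (σ * swap u v) a = b) u v a b) :
    Relation.EqvGen (linkRel (fun a b => r a b ∨ σ a = b) u v) a b := by
  rcases h with (h | h) | h
  · exact .rel _ _ (Or.inl (Or.inl h))
  · exact eqvGen_link_of_mul_swap (fun a b h => Or.inr h) a b h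
  · exact .rel _ _ (Or.inr h)

theorem classCount_link_or_mul_swap (r : D → D → Prop) (σ : Perm D) (u v : D) :
    classCount (linkRel (fun a b => r a b ∨ (σ * swap u v) a = b) u v) =
      classCount (linkRel (fun a b => r a b ∨ σ a = b) u v) := by
  refine classCount_congr (fun a b h => ?_) (fun a b h => eqvGen_link_or_mul_swap r σ u v a b h)
  have h' : linkRel (fun a b => r a b ∨ (σ * swap u v * swap u v) a = b) u v a b := by
    rwa [mul_assoc, swap_mul_self, mul_one]
  exact eqvGen_link_or_mul_swap r (σ * swap u v) u v a b h'

theorem classCount_or_mul_swap_le (r : D → D → Prop) (σ : Perm D) (u v : D) :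
    classCount (fun a b => r a b ∨ (σ * swap u v) a = b) ≤
      classCount (fun a b => r a b ∨ σ a = b) + 1 := by
  refine (classCount_le_link _ u v).trans ?_
  rw [classCount_link_or_mul_swap]
  exact Nat.add_le_add_right (classCount_mono fun a b h => .rel _ _ (Or.inl h)) 1

theorem classCount_or_mul_swap_le_of_eqvGen {r : D → D → Prop} {σ : Perm D} {u v : D}
    (h : Relation.EqvGen (fun a b => r a b ∨ (σ * swap u v) a = b) u v) :
    classCount (fun a b => r a b ∨ (σ * swap u v) a = b) ≤
      classCount (fun a b => r a b ∨ σ a = b) := by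
  refine (classCount_le_link_of_eqvGen h).trans ?_
  rw [classCount_link_or_mul_swap]
  exact classCount_mono fun a b h => .rel _ _ (Or.inl h)

theorem classCount_or_mul_swap_lt {r : D → D → Prop} {σ : Perm D} {u v : D}
    (h : Relation.EqvGen (fun a b => r a b ∨ (σ * swap u v) a = b) u v)
    (h' : ¬ Relation.EqvGen (fun a b => r a b ∨ σ a = b) u v) :
    classCount (fun a b => r a b ∨ (σ * swap u v) a = b) + 1 ≤
      classCount (fun a b => r a b ∨ σ a = b) := by
  refine (Nat.add_le_add_right (classCount_le_link_of_eqvGen h) 1).trans ?_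
  rw [classCount_link_or_mul_swap]
  exact classCount_link_lt h'

omit [Finite D] [DecidableEq D] in
theorem cycleCount_eq (σ : Perm D) :
    cycleCount σ = classCount fun a b => (fun _ _ => False) a b ∨ σ a = b := by
  simp [cycleCount]

theorem cycleCount_mul_swap_le (σ : Perm D) (u v : D) :
    cycleCount (σ * swap u v) ≤ cycleCount σ + 1 := by
  rw [cycleCount_eq, cycleCount_eq]
  exact classCount_or_mul_swap_le _ σ u v

theorem le_cycleCount_mul_swap (σ : Perm D) (u v : D) :
    cycleCount σ ≤ cycleCount (σ * swap u v) + 1 := by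
  have := cycleCount_mul_swap_le (σ * swap u v) u v
  rwa [mul_assoc, swap_mul_self, mul_one] at this

theorem cycleCount_lt_mul_swap {σ : Perm D} {u v : D} (h : σ.SameCycle u v) (huv : u ≠ v) :
    cycleCount σ + 1 ≤ cycleCount (σ * swap u v) := by
  have := classCount_or_mul_swap_lt (r := fun _ _ => False) (σ := σ * swap u v) (u := u) (v := v)
    (by simpa [mul_assoc, eqvGen_perm_iff] using h)
    (by simpa only [false_or, eqvGen_perm_iff] using not_sameCycle_mul_swap h huv)
  rw [cycleCount_eq, cycleCount_eq]
  rwa [mul_assoc, swap_mul_self, mul_one] at this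

/-- Multiplying by a transposition changes the number of cycles by one, and it can only split a
component by splitting a cycle. -/
theorem mul_swap_tradeoff (r : D → D → Prop) (σ : Perm D) (u v : D) :
    cycleCount σ + 2 * classCount (fun a b => r a b ∨ (σ * swap u v) a = b) ≤
      cycleCount (σ * swap u v) + 2 * classCount (fun a b => r a b ∨ σ a = b) + 1 := by
  by_cases h : (σ * swap u v).SameCycle u v
  · have h1 := le_cycleCount_mul_swap σ u v
    have h2 := classCount_or_mul_swap_le_of_eqvGen (r := r) (σ := σ) (u := u) (v := v)
      (((eqvGen_perm_iff _ _ _).2 h).mono fun a b h => Or.inr h)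
    omega
  · have h0 : σ.SameCycle u v := by
      by_contra hc
      exact h (sameCycle_mul_swap_of_not hc)
    have huv : u ≠ v := by
      rintro rfl
      exact h (Perm.SameCycle.refl _ _)
    have h1 := cycleCount_lt_mul_swap h0 huv
    have h2 := classCount_or_mul_swap_le r σ u v
    omega

omit [Finite D] in
theorem swap_mul_eq (φ : Perm D) (a b : D) :
    swap a b * φ = φ * swap (φ⁻¹ a) (φ⁻¹ b) := by
  rw [Equiv.mul_swap_eq_swap_mul]
  simp

theorem le_cycleCount_swap_mul (φ : Perm D) (a b : D) :
    cycleCount φ ≤ cycleCount (swap a b * φ) + 1 := by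
  rw [swap_mul_eq]
  exact le_cycleCount_mul_swap _ _ _

theorem cycleCount_lt_swap_mul {φ : Perm D} {a b : D} (h : φ.SameCycle a b) (hab : a ≠ b) :
    cycleCount φ + 1 ≤ cycleCount (swap a b * φ) := by
  rw [swap_mul_eq]
  exact cycleCount_lt_mul_swap (by simpa using h) (by simpa using hab)

theorem IsPlanar.swap_mul {φ α : Perm D} (h : IsPlanar φ α) {a b : D} (hs : φ.SameCycle a b)
    (hab : a ≠ b) : IsPlanar (swap a b * φ) α := by
  unfold IsPlanar at *
  have h1 := cycleCount_lt_swap_mul hs hab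
  have h2 := mul_swap_tradeoff (fun a b => α a = b) (α * φ) (φ⁻¹ a) (φ⁻¹ b)
  have h3 : α * φ * swap (φ⁻¹ a) (φ⁻¹ b) = α * (swap a b * φ) := by rw [swap_mul_eq, mul_assoc]
  rw [h3, ← componentCount_eq_alpha, ← componentCount_eq_alpha] at h2
  omega

omit [DecidableEq D] in
theorem componentCount_eq_beta (φ α : Perm D) :
    componentCount φ α = classCount fun a b => (α * φ) a = b ∨ α a = b := by
  rw [componentCount_eq_alpha]
  simp only [or_comm]

omit [Finite D] in
theorem mul_swap_mul_swap_mul (φ α : Perm D) (a b : D) :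
    (α * swap a b) * (swap a b * φ) = α * φ := by
  rw [mul_assoc, swap_mul_self_mul]

theorem IsPlanar.swap_mul_mul_swap {φ α : Perm D} (h : IsPlanar φ α) {a b : D}
    (hs : φ.SameCycle a b) (hab : a ≠ b) : IsPlanar (swap a b * φ) (α * swap a b) := by
  unfold IsPlanar at *
  have h1 := cycleCount_lt_swap_mul hs hab
  have h2 := mul_swap_tradeoff (fun c d => (α * φ) c = d) α a b
  have h3 := componentCount_eq_beta (swap a b * φ) (α * swap a b)
  rw [mul_swap_mul_swap_mul] at h3
  rw [← componentCount_eq_beta, ← h3] at h2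
  rw [mul_swap_mul_swap_mul]
  omega

theorem sameCycle_swap_mul_of_not {φ : Perm D} {a b : D} (h : ¬ φ.SameCycle a b) :
    (swap a b * φ).SameCycle a b := by
  rw [swap_mul_eq]
  have := sameCycle_mul_swap_of_not (σ := φ) (u := φ⁻¹ a) (v := φ⁻¹ b) (by simpa using h)
  rw [← Perm.sameCycle_apply_left, ← Perm.sameCycle_apply_right] at this
  rw [Perm.mul_apply, swap_apply_left, Perm.mul_apply, swap_apply_right] at this
  simpa using this.symm

theorem IsPlanar.merge {φ α : Perm D} (h : IsPlanar φ α) {a b : D}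
    (hs : ¬ φ.SameCycle a b) (hα : α.SameCycle a b) :
    IsPlanar (swap a b * φ) (α * swap a b) := by
  unfold IsPlanar at *
  have hab : a ≠ b := by
    rintro rfl
    exact hs (Perm.SameCycle.refl _ _)
  have h1 := le_cycleCount_swap_mul φ a b
  have h2 := cycleCount_lt_mul_swap hα hab
  have h3 := componentCount_eq_beta (swap a b * φ) (α * swap a b)
  have h4 := classCount_or_mul_swap_le_of_eqvGen (r := fun c d => (α * φ) c = d) (σ := α)
    (u := a) (v := b) ?_
  · rw [mul_swap_mul_swap_mul] at h3
    rw [← componentCount_eq_beta, ← h3] at h4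
    rw [mul_swap_mul_swap_mul]
    omega
  · have h5 := (eqvGen_perm_iff _ _ _).2 (sameCycle_swap_mul_of_not hs)
    refine eqvGen_bind (fun c d hcd => ?_) h5
    have h6 := eqvGen_alpha_beta (swap a b * φ) (α * swap a b) c d hcd
    rw [mul_swap_mul_swap_mul] at h6
    exact h6.mono fun _ _ => Or.symm

theorem IsPlanar.insert_alpha {φ α : Perm D} (h : IsPlanar φ α) {p q : D} (hφ : φ p = p)
    (hα : α p = p) (hpq : p ≠ q) : IsPlanar (swap p q * φ) (α * swap p q) := by
  unfold IsPlanar at *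
  have h1 := le_cycleCount_swap_mul φ p q
  have h2 := le_cycleCount_mul_swap α p q
  have h3 := componentCount_eq_beta (swap p q * φ) (α * swap p q)
  have hs : ¬ φ.SameCycle p q := by
    intro hc
    rw [← eqvGen_perm_iff] at hc
    refine hpq.symm (eq_of_eqvGen_of_isolated ?_ hc)
    rintro a _ rfl
    rw [← φ.injective.eq_iff (a := a), hφ]
  have h4 := classCount_or_mul_swap_lt (r := fun c d => (α * φ) c = d) (σ := α)
    (u := p) (v := q) ?_ ?_
  · rw [mul_swap_mul_swap_mul] at h3
    rw [← componentCount_eq_beta, ← h3] at h4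
    rw [mul_swap_mul_swap_mul]
    omega
  · have h5 := (eqvGen_perm_iff _ _ _).2 (sameCycle_swap_mul_of_not hs)
    refine eqvGen_bind (fun c d hcd => ?_) h5
    have h6 := eqvGen_alpha_beta (swap p q * φ) (α * swap p q) c d hcd
    rw [mul_swap_mul_swap_mul] at h6
    exact h6.mono fun _ _ => Or.symm
  · intro hc
    refine hpq.symm (eq_of_eqvGen_of_isolated ?_ hc)
    rintro a _ (rfl | rfl)
    · rw [← (α * φ).injective.eq_iff (a := a), Perm.mul_apply α φ p, hφ, hα]
    · rw [← α.injective.eq_iff (a := a), hα]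

theorem IsPlanar.insert_beta {φ α : Perm D} (h : IsPlanar φ α) {p q : D} (hφ : φ p = p)
    (hα : α p = p) (hpq : p ≠ q) : IsPlanar (swap p q * φ) α := by
  unfold IsPlanar at *
  have h1 := le_cycleCount_swap_mul φ p q
  have h2 := le_cycleCount_mul_swap (α * φ) (φ⁻¹ p) (φ⁻¹ q)
  have h3 : α * φ * swap (φ⁻¹ p) (φ⁻¹ q) = α * (swap p q * φ) := by rw [swap_mul_eq, mul_assoc]
  have hp : φ⁻¹ p = p := by rw [Perm.inv_eq_iff_eq, hφ]
  have h4 := classCount_or_mul_swap_lt (r := fun c d => α c = d) (σ := α * φ)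
    (u := φ⁻¹ p) (v := φ⁻¹ q) ?_ ?_
  · rw [h3, ← componentCount_eq_alpha, ← componentCount_eq_alpha] at h4
    rw [h3] at h2
    omega
  · rw [h3, hp]
    refine .symm _ _ (eqvGen_alpha_beta _ _ _ _ ?_)
    simp
  · rw [hp]
    intro hc
    have : φ⁻¹ q = p := by
      refine eq_of_eqvGen_of_isolated ?_ hc
      rintro a _ (rfl | rfl)
      · rw [← α.injective.eq_iff (a := a), hα]
      · rw [← (α * φ).injective.eq_iff (a := a), Perm.mul_apply α φ p, hφ, hα]
    rw [Perm.inv_eq_iff_eq, hφ] at this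
    exact hpq this.symm

theorem IsPlanar.detach {φ α : Perm D} (h : IsPlanar φ α) {p : D} (hφ : φ p = p) :
    IsPlanar φ (swap p (α p) * α) := by
  by_cases hp : α p = p
  · rwa [hp, swap_self, show (Equiv.refl D : Perm D) = 1 from rfl, one_mul]
  unfold IsPlanar at *
  have hs : α.SameCycle p (α p) := Perm.sameCycle_apply_right.2 (Perm.SameCycle.refl _ _)
  have h1 := cycleCount_lt_swap_mul hs (Ne.symm hp)
  have hs' : (α * φ).SameCycle p (α p) := by
    have := Perm.sameCycle_apply_right.2 (Perm.SameCycle.refl (α * φ) p)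
    rwa [Perm.mul_apply, hφ] at this
  have h2 := cycleCount_lt_swap_mul hs' (Ne.symm hp)
  have h3 := classCount_or_mul_swap_le (fun a b => φ a = b) α (α⁻¹ p) (α⁻¹ (α p))
  rw [← swap_mul_eq] at h3
  rw [← mul_assoc] at h2
  unfold componentCount at *
  omega

end Ops

theorem classCount_option [Finite D] {r : Option D → Option D → Prop} {s : D → D → Prop}
    (h : ∀ a b, r (some a) (some b) ↔ s a b) (h1 : ∀ a, ¬ r (some a) none)
    (h2 : ∀ a, ¬ r none (some a)) : classCount r = classCount s + 1 := by
  have e : Quot r ≃ Option (Quot s) :=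
    { toFun := Quot.lift (fun o => o.map (Quot.mk s)) (by
        rintro (_ | a) (_ | b) hab
        · rfl
        · exact (h2 _ hab).elim
        · exact (h1 _ hab).elim
        · exact congrArg some (Quot.sound ((h a b).1 hab)))
      invFun := fun o => o.elim (Quot.mk r none)
        (Quot.lift (fun a => Quot.mk r (some a)) fun a b hab => Quot.sound ((h a b).2 hab))
      left_inv := by
        rintro ⟨_ | a⟩ <;> rfl
      right_inv := by
        rintro (_ | a)
        · rfl
        · induction a using Quot.ind
          rfl }
  unfold classCount
  rw [Nat.card_congr e, Finite.card_option]

theorem IsPlanar.option [Finite D] {φ α : Perm D} (h : IsPlanar φ α) :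
    IsPlanar (optionCongr φ) (optionCongr α) := by
  have key : ∀ σ : Perm D, cycleCount (optionCongr σ : Perm (Option D)) = cycleCount σ + 1 :=
    fun σ => classCount_option (by simp) (by simp) (by simp)
  have h1 : (optionCongr α : Perm (Option D)) * optionCongr φ = optionCongr (α * φ) := by
    ext1 o
    cases o <;> rfl
  have h2 : componentCount (optionCongr φ) (optionCongr α) = componentCount φ α + 1 :=
    classCount_option (by simp) (by simp) (by simp)
  unfold IsPlanar at *
  rw [h1, key, key, key, h2, Finite.card_option]
  omega

end Planar

/-- The homomorphism from `ℤ/2` to the symmetric group on three letters. -/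
def symX (a : ZMod 2) : Perm (Fin 3) := swap 0 1 ^ a.val

/-- The homomorphism from `ℤ/3` to the symmetric group on three letters. -/
def symY (b : ZMod 3) : Perm (Fin 3) := finRotate 3 ^ b.val

theorem symX_add : ∀ a b, symX (a + b) = symX a * symX b := by decide
theorem symY_add : ∀ a b, symY (a + b) = symY a * symY b := by decide
theorem symX_zero : symX 0 = 1 := by decide
theorem symY_zero : symY 0 = 1 := by decide
theorem symX_eq_one : ∀ a, symX a = 1 → a = 0 := by decide
theorem symY_eq_one : ∀ a, symY a = 1 → a = 0 := by decide

/-- Evaluation of a word in the syllables `x ^ a * y ^ b` in the symmetric group. -/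
def symEval (w : List (ZMod 2 × ZMod 3)) : Perm (Fin 3) :=
  (w.map fun s => symX s.1 * symY s.2).prod

/-- `Ls` lists the nontrivial cycles of `φ`; the darts outside of `Ls` are isolated. -/
structure IsFaceList {D : Type} (φ α : Perm D) (Ls : List (List D)) : Prop where
  nodup : Ls.flatten.Nodup
  map_eq : ∀ l ∈ Ls, l.map φ = l.rotate 1
  fixed : ∀ d ∉ Ls.flatten, φ d = d ∧ α d = d

/-- A planar hypermap whose darts are labelled by syllables `x ^ a * y ^ b`, together with a
compatible map to the symmetric group on three letters. -/
structure Diagram (D : Type) where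
  face : Perm D
  vert : Perm D
  lab : D → ZMod 2 × ZMod 3
  hol : D → Perm (Fin 3)
  faces : List (List D)
  planar : IsPlanar face vert
  hol_face : ∀ d, hol (face d) = hol d * symX (lab d).1 * symY (lab d).2
  hol_vert : ∀ d, hol (vert d) * symX (lab (vert d)).1 = hol d
  isFaceList : IsFaceList face vert faces

/-- There is a planar diagram whose faces carry the given words. -/
def Realizable (L : List (List (ZMod 2 × ZMod 3))) : Prop :=
  ∃ (D : Type) (_ : Finite D) (M : Diagram D), M.faces.map (List.map M.lab) = L

namespace IsFaceList
variable {D : Type} [DecidableEq D] {φ α α' : Perm D} {Ls Ls' : List (List D)} {a b : D}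
  {A B : List D}

omit [DecidableEq D] in
theorem perm (h : IsFaceList φ α Ls) (hp : Ls.Perm Ls') : IsFaceList φ α Ls' where
  nodup := hp.flatten.nodup_iff.1 h.nodup
  map_eq l hl := h.map_eq l (hp.mem_iff.2 hl)
  fixed d hd := h.fixed d fun hc => hd (hp.flatten.mem_iff.1 hc)

theorem map_swap_of_notMem {l : List D} (ha : a ∉ l) (hb : b ∉ l) : l.map (swap a b) = l := by
  conv_rhs => rw [← l.map_id]
  refine List.map_congr_left fun d hd => swap_apply_of_ne_of_ne ?_ ?_
  · rintro rfl; exact ha hd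
  · rintro rfl; exact hb hd

omit [DecidableEq D] in
theorem map_perm_mul (σ φ : Perm D) (l : List D) : l.map (σ * φ) = (l.map φ).map σ := by
  simp [List.map_map, Perm.coe_mul]

omit [DecidableEq D] in
theorem map_split (h : (a :: A ++ b :: B).map φ = (a :: A ++ b :: B).rotate 1) :
    (a :: A).map φ = A ++ [b] ∧ (b :: B).map φ = B ++ [a] := by
  rw [List.map_append, show (a :: A ++ b :: B).rotate 1 = (A ++ [b]) ++ (B ++ [a]) by simp] at h
  exact List.append_inj h (by simp)

theorem split (h : IsFaceList φ α ((a :: A ++ b :: B) :: Ls)) (hα : ∀ d, α d = d → d ≠ a → d ≠ b →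
    α' d = d) : IsFaceList (swap a b * φ) α' ((a :: A) :: (b :: B) :: Ls) := by
  have hn := h.nodup
  have hf : ((a :: A) :: (b :: B) :: Ls).flatten = ((a :: A ++ b :: B) :: Ls).flatten := by simp
  simp only [List.flatten_cons, List.nodup_append', List.nodup_cons, List.cons_append,
    List.disjoint_cons_left, List.mem_append, List.mem_cons, not_or, List.disjoint_append_left,
    List.disjoint_cons_right] at hn
  obtain ⟨h1, h2⟩ := map_split (h.map_eq (a :: A ++ b :: B) (by simp))
  refine ⟨hf ▸ h.nodup, ?_, ?_⟩
  · intro l hl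
    simp only [List.mem_cons] at hl
    rw [map_perm_mul]
    rcases hl with rfl | rfl | hl
    · rw [h1, List.map_append, map_swap_of_notMem (by tauto) (by tauto)]
      simp
    · rw [h2, List.map_append, map_swap_of_notMem (by tauto) (by tauto)]
      simp
    · rw [h.map_eq l (by simp [hl]), map_swap_of_notMem]
      all_goals
        rw [List.mem_rotate]
        intro hc
        have := List.mem_flatten.2 ⟨l, hl, hc⟩
        tauto
  · intro d hd
    rw [hf] at hd
    obtain ⟨h3, h4⟩ := h.fixed d hd
    have ha : d ≠ a := by rintro rfl; simp at hd
    have hb : d ≠ b := by rintro rfl; simp at hd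
    exact ⟨by rw [Perm.mul_apply, h3, swap_apply_of_ne_of_ne ha hb], hα d h4 ha hb⟩

theorem merge (h : IsFaceList φ α ((a :: A) :: (b :: B) :: Ls)) (hα : ∀ d, α d = d → d ≠ a →
    d ≠ b → α' d = d) : IsFaceList (swap a b * φ) α' ((a :: A ++ b :: B) :: Ls) := by
  have hn := h.nodup
  have hf : ((a :: A) :: (b :: B) :: Ls).flatten = ((a :: A ++ b :: B) :: Ls).flatten := by simp
  rw [hf] at hn
  simp only [List.flatten_cons, List.nodup_append', List.nodup_cons, List.cons_append,
    List.disjoint_cons_left, List.mem_append, List.mem_cons, not_or, List.disjoint_append_left,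
    List.disjoint_cons_right] at hn
  have h1 : (a :: A).map φ = A ++ [a] := (h.map_eq _ (by simp)).trans (by simp)
  have h2 : (b :: B).map φ = B ++ [b] := (h.map_eq _ (by simp)).trans (by simp)
  refine ⟨hf ▸ h.nodup, ?_, ?_⟩
  · intro l hl
    simp only [List.mem_cons] at hl
    rw [map_perm_mul]
    rcases hl with rfl | hl
    · rw [List.map_append, h1, h2, List.map_append, List.map_append, List.map_append,
        map_swap_of_notMem (l := A) (by tauto) (by tauto),
        map_swap_of_notMem (l := B) (by tauto) (by tauto)]
      simp
    · rw [h.map_eq l (by simp [hl]), map_swap_of_notMem]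
      all_goals
        rw [List.mem_rotate]
        intro hc
        have := List.mem_flatten.2 ⟨l, hl, hc⟩
        tauto
  · intro d hd
    obtain ⟨h3, h4⟩ := h.fixed d (hf ▸ hd)
    have ha : d ≠ a := by rintro rfl; simp at hd
    have hb : d ≠ b := by rintro rfl; simp at hd
    exact ⟨by rw [Perm.mul_apply, h3, swap_apply_of_ne_of_ne ha hb], hα d h4 ha hb⟩

end IsFaceList

theorem Realizable.perm {L L' : List (List (ZMod 2 × ZMod 3))} (h : Realizable L)
    (hp : L.Perm L') : Realizable L' := by
  obtain ⟨D, _, M, rfl⟩ := h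
  obtain ⟨Ls', h2, h1⟩ : Relation.Comp (fun L Ls => L = List.map (List.map M.lab) Ls)
      List.Perm L' M.faces := by
    rw [List.eq_map_comp_perm]
    exact hp.symm
  exact ⟨D, inferInstance, { M with faces := Ls', isFaceList := M.isFaceList.perm h1.symm }, h2.symm⟩

theorem IsFaceList.rotate {D : Type} {φ α : Perm D} {U V : List D} {Ls : List (List D)}
    (hf : IsFaceList φ α ((U ++ V) :: Ls)) : IsFaceList φ α ((V ++ U) :: Ls) := by
  refine ⟨?_, ?_, ?_⟩
  · refine (List.Perm.nodup_iff ?_).1 hf.nodup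
    simpa [← List.append_assoc] using (List.perm_append_comm (l₁ := U) (l₂ := V)).append_right _
  · intro l hl
    rcases List.mem_cons.1 hl with rfl | hl
    · have h3 := congrArg (fun l => l.rotate U.length) (hf.map_eq _ List.mem_cons_self)
      rw [← List.map_rotate, List.rotate_rotate, Nat.add_comm, ← List.rotate_rotate] at h3
      simpa using h3
    · exact hf.map_eq l (List.mem_cons_of_mem _ hl)
  · intro d hd
    refine hf.fixed d ?_
    simp only [List.flatten_cons, List.mem_append] at hd ⊢
    tauto

theorem Realizable.rotate {u v : List (ZMod 2 × ZMod 3)} {L : List (List (ZMod 2 × ZMod 3))}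
    (h : Realizable ((u ++ v) :: L)) : Realizable ((v ++ u) :: L) := by
  obtain ⟨D, _, M, hM⟩ := h
  obtain ⟨l, Ls, h1, h2, rfl⟩ := List.map_eq_cons_iff.1 hM
  obtain ⟨U, V, rfl, rfl, rfl⟩ := List.map_eq_append_iff.1 h2
  have hf := M.isFaceList
  rw [h1] at hf
  exact ⟨D, inferInstance, { M with faces := (V ++ U) :: Ls, isFaceList := hf.rotate }, by simp⟩

theorem realizable_nil_cons {L : List (List (ZMod 2 × ZMod 3))} :
    Realizable ([] :: L) ↔ Realizable L := by
  constructor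
  · rintro ⟨D, _, M, hM⟩
    obtain ⟨l, Ls, h1, h2, rfl⟩ := List.map_eq_cons_iff.1 hM
    obtain rfl := List.map_eq_nil_iff.1 h2
    have hf := M.isFaceList
    rw [h1] at hf
    exact ⟨D, inferInstance, { M with
      faces := Ls
      isFaceList := ⟨by simpa using hf.nodup,
        fun l hl => hf.map_eq l (List.mem_cons_of_mem _ hl),
        fun d hd => hf.fixed d (by simpa using hd)⟩ }, rfl⟩
  · rintro ⟨D, _, M, rfl⟩
    have hf := M.isFaceList
    exact ⟨D, inferInstance, { M with
      faces := [] :: M.faces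
      isFaceList := ⟨by simpa using hf.nodup,
        fun l hl => (List.mem_cons.1 hl).elim (by rintro rfl; rfl) (hf.map_eq l),
        fun d hd => hf.fixed d (by simpa using hd)⟩ }, rfl⟩

namespace Diagram
variable {D : Type} (M : Diagram D)

theorem chain {a b : D} {A : List D} (h : (a :: A).map M.face = A ++ [b]) :
    M.face.SameCycle a b ∧ M.hol b = M.hol a * symEval ((a :: A).map M.lab) := by
  induction A generalizing a with
  | nil =>
    obtain rfl : M.face a = b := by simpa using h
    exact ⟨Perm.sameCycle_apply_right.2 (Perm.SameCycle.refl _ _), by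
      simp [symEval, M.hol_face, mul_assoc]⟩
  | cons c A ih =>
    obtain ⟨h1, h2⟩ : M.face a = c ∧ (c :: A).map M.face = A ++ [b] := by simpa using h
    obtain ⟨h3, h4⟩ := ih h2
    subst h1
    refine ⟨Perm.sameCycle_apply_left.1 h3, ?_⟩
    rw [h4, M.hol_face]
    simp [symEval, mul_assoc]

theorem face_mem {l : List D} (hl : l ∈ M.faces) {d : D} (hd : d ∈ l) : M.face d ∈ l := by
  have := List.mem_map_of_mem (f := M.face) hd
  rwa [M.isFaceList.map_eq l hl, List.mem_rotate] at this

end Diagram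

theorem map_ite_of_notMem {D β : Type} [DecidableEq D] {l : List D} {p q : D} (f : D → β) (s t : β)
    (hp : p ∉ l) (hq : q ∉ l) :
    l.map (fun d => if d = p then s else if d = q then t else f d) = l.map f := by
  refine List.map_congr_left fun d hd => ?_
  rw [if_neg (by rintro rfl; exact hp hd), if_neg (by rintro rfl; exact hq hd)]

theorem map_map_ite_of_notMem {D β : Type} [DecidableEq D] {Ls : List (List D)} {p q : D}
    (f : D → β) (s t : β) (hp : p ∉ Ls.flatten) (hq : q ∉ Ls.flatten) :
    Ls.map (List.map fun d => if d = p then s else if d = q then t else f d) =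
      Ls.map (List.map f) := by
  refine List.map_congr_left fun l hl => map_ite_of_notMem f s t ?_ ?_
  · exact fun h => hp (List.mem_flatten.2 ⟨l, hl, h⟩)
  · exact fun h => hq (List.mem_flatten.2 ⟨l, hl, h⟩)

theorem Realizable.split {u v : List (ZMod 2 × ZMod 3)} {L : List (List (ZMod 2 × ZMod 3))}
    (h : Realizable ((u ++ v) :: L)) (hu : symEval u = 1) : Realizable (u :: v :: L) := by
  classical
  obtain ⟨D, _, M, hM⟩ := h
  obtain ⟨l, Ls, h1, h2, rfl⟩ := List.map_eq_cons_iff.1 hM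
  obtain ⟨U, V, rfl, rfl, rfl⟩ := List.map_eq_append_iff.1 h2
  rcases U with _ | ⟨a, A⟩
  · exact realizable_nil_cons.2 ⟨D, inferInstance, M, hM⟩
  rcases V with _ | ⟨b, B⟩
  · refine Realizable.perm (realizable_nil_cons.2 ⟨D, inferInstance, M, hM⟩) ?_
    simpa using List.Perm.swap _ _ _
  have hf := M.isFaceList
  rw [h1] at hf
  obtain ⟨h3, -⟩ := IsFaceList.map_split (hf.map_eq (a :: A ++ b :: B) (by simp))
  obtain ⟨h4, h5⟩ := M.chain h3
  rw [hu, mul_one] at h5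
  have hab : a ≠ b := by
    have := hf.nodup
    simp at this
    tauto
  refine ⟨D, inferInstance, { M with
    face := swap a b * M.face
    faces := (a :: A) :: (b :: B) :: Ls
    planar := M.planar.swap_mul h4 hab
    hol_face := fun d => ?_
    isFaceList := hf.split fun d h _ _ => h }, by simp⟩
  rw [← M.hol_face, Perm.mul_apply]
  generalize M.face d = c
  by_cases hca : c = a
  · rw [hca, swap_apply_left, h5]
  by_cases hcb : c = b
  · rw [hcb, swap_apply_right, h5]
  · rw [swap_apply_of_ne_of_ne hca hcb]

theorem Realizable.contract_left {f₁ f₂ : ZMod 2} {e : ZMod 3} {w : List (ZMod 2 × ZMod 3)}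
    {L : List (List (ZMod 2 × ZMod 3))} (h : Realizable (((f₁, 0) :: (f₂, e) :: w) :: L)) :
    Realizable ([(0, 0)] :: ((f₁ + f₂, e) :: w) :: L) := by
  classical
  obtain ⟨D, _, M, hM⟩ := h
  obtain ⟨l, Ls, h1, h2, rfl⟩ := List.map_eq_cons_iff.1 hM
  obtain ⟨p, l, rfl, hp, h2⟩ := List.map_eq_cons_iff.1 h2
  obtain ⟨q, l, rfl, hq, rfl⟩ := List.map_eq_cons_iff.1 h2
  have hf := M.isFaceList
  rw [h1] at hf
  have hn := hf.nodup
  simp only [List.flatten_cons, List.nodup_append', List.nodup_cons, List.mem_cons, not_or] at hn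
  obtain ⟨⟨⟨hpq, hpl⟩, hql, -⟩, -, hdisj⟩ := hn
  have hpq' : M.face p = q := by
    simpa using (IsFaceList.map_split (a := p) (A := []) (hf.map_eq (p :: q :: l) (by simp))).1
  have hs : M.face.SameCycle p q := hpq' ▸ Perm.sameCycle_apply_right.2 (Perm.SameCycle.refl _ _)
  have hx : M.hol q = M.hol p * symX f₁ := by
    rw [← hpq', M.hol_face, hp, symY_zero, mul_one]
  refine ⟨D, inferInstance,
    { face := swap p q * M.face
      vert := M.vert * swap p q
      lab := fun d => if d = p then (0, 0) else if d = q then (f₁ + f₂, e) else M.lab d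
      hol := fun d => M.hol (swap p q d)
      faces := [p] :: (q :: l) :: Ls
      planar := M.planar.swap_mul_mul_swap hs hpq
      hol_face := fun d => ?_
      hol_vert := fun d => ?_
      isFaceList := IsFaceList.split (A := []) hf fun d h hp hq => by
        rw [Perm.mul_apply, swap_apply_of_ne_of_ne hp hq, h] }, ?_⟩
  · rw [Perm.mul_apply, swap_apply_self, M.hol_face]
    by_cases hdp : d = p
    · subst hdp
      simp [hp, hx, symX_zero, symY_zero]
    by_cases hdq : d = q
    · subst hdq
      simp [hdp, hq, hx, symX_add, mul_assoc]
    · simp [hdp, hdq, swap_apply_of_ne_of_ne]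
  · rw [Perm.mul_apply, ← M.hol_vert (swap p q d)]
    generalize M.vert (swap p q d) = c
    by_cases hdp : c = p
    · subst hdp
      simp [hp, hx, symX_zero]
    by_cases hdq : c = q
    · subst hdq
      simp [hdp, hq, hx, symX_add, mul_assoc]
    · simp [hdp, hdq, swap_apply_of_ne_of_ne]
  · have hpL : p ∉ Ls.flatten := fun h => hdisj (by simp) h
    have hqL : q ∉ Ls.flatten := fun h => hdisj (by simp) h
    simp [map_map_ite_of_notMem _ _ _ hpL hqL, map_ite_of_notMem _ _ _ hpl hql, Ne.symm hpq]

theorem Realizable.contract_right {f : ZMod 2} {e₁ e₂ : ZMod 3} {w : List (ZMod 2 × ZMod 3)}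
    {L : List (List (ZMod 2 × ZMod 3))} (h : Realizable (((0, e₂) :: (w ++ [(f, e₁)])) :: L)) :
    Realizable ([(0, 0)] :: (w ++ [(f, e₁ + e₂)]) :: L) := by
  classical
  obtain ⟨D, _, M, hM⟩ := h
  obtain ⟨l, Ls, h1, h2, rfl⟩ := List.map_eq_cons_iff.1 hM
  obtain ⟨p, l, rfl, hp, h2⟩ := List.map_eq_cons_iff.1 h2
  obtain ⟨l, l', rfl, rfl, h3⟩ := List.map_eq_append_iff.1 h2
  obtain ⟨q, l', rfl, hq, h3⟩ := List.map_eq_cons_iff.1 h3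
  obtain rfl := List.map_eq_nil_iff.1 h3
  have hf := M.isFaceList
  rw [h1] at hf
  have hn := hf.nodup
  simp only [List.flatten_cons, List.nodup_append', List.nodup_cons, List.mem_append,
    List.mem_singleton, not_or, List.disjoint_singleton] at hn
  obtain ⟨⟨⟨hpl, hpq⟩, -, -, hql⟩, -, hdisj⟩ := hn
  have hm := hf.map_eq (p :: (l ++ [q])) (by simp)
  have hqp : M.face q = p := by
    have hm' : (p :: l).map M.face ++ [M.face q] = (l ++ [q]) ++ [p] := by
      simpa using hm
    simpa using (List.append_inj hm' (by simp)).2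
  obtain ⟨c, C, hC⟩ : ∃ c C, l ++ [q] = c :: C := by cases l <;> simp
  have hpc : M.face p = c := by
    rw [hC] at hm
    simpa using (IsFaceList.map_split (a := p) (A := []) hm).1
  have hc : c ∈ l ++ [q] := hC ▸ List.mem_cons_self
  have hpc' : p ≠ c := by
    rintro rfl
    rcases List.mem_append.1 hc with h | h
    · exact hpl h
    · exact hpq (List.mem_singleton.1 h)
  have hs : M.face.SameCycle p c := hpc ▸ Perm.sameCycle_apply_right.2 (Perm.SameCycle.refl _ _)
  have hx : M.hol c = M.hol p * symY e₂ := by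
    rw [← hpc, M.hol_face, hp, symX_zero, mul_one]
  have hx' : M.hol p = M.hol q * symX f * symY e₁ := by
    rw [← hqp, M.hol_face, hq]
  have hf' : IsFaceList M.face M.vert ((p :: [] ++ c :: C) :: Ls) := by
    rw [← hC]
    exact hf
  refine ⟨D, inferInstance,
    { face := swap p c * M.face
      vert := M.vert
      lab := fun d => if d = p then (0, 0) else if d = q then (f, e₁ + e₂) else M.lab d
      hol := M.hol
      faces := [p] :: (c :: C) :: Ls
      planar := M.planar.swap_mul hs hpc'
      hol_face := fun d => ?_
      hol_vert := fun d => ?_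
      isFaceList := hf'.split fun d h _ _ => h }, ?_⟩
  · rw [Perm.mul_apply]
    by_cases hdp : d = p
    · subst hdp
      simp [hpc, symX_zero, symY_zero]
    by_cases hdq : d = q
    · subst hdq
      simp [hdp, hqp, hx, hx', symY_add, mul_assoc]
    · have h3 : M.face d ≠ p := by
        rw [← hqp, M.face.injective.ne_iff]
        exact hdq
      have h4 : M.face d ≠ c := by
        rw [← hpc, M.face.injective.ne_iff]
        exact hdp
      simp [hdp, hdq, swap_apply_of_ne_of_ne h3 h4, M.hol_face]
  · rw [← M.hol_vert d]
    generalize M.vert d = c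
    by_cases hdp : c = p
    · subst hdp
      simp [hp]
    by_cases hdq : c = q
    · subst hdq
      simp [hdp, hq]
    · simp [hdp, hdq]
  · have hpL : p ∉ Ls.flatten := fun h => hdisj (by simp) h
    have hqL : q ∉ Ls.flatten := fun h => hdisj (by simp) h
    have hql' : q ∉ l := fun h => hql h
    simp [← hC, map_map_ite_of_notMem _ _ _ hpL hqL, map_ite_of_notMem _ _ _ hpl hql',
      Ne.symm hpq]

theorem Realizable.remove_monogon {L : List (List (ZMod 2 × ZMod 3))}
    (h : Realizable ([(0, 0)] :: L)) : Realizable L := by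
  classical
  obtain ⟨D, _, M, hM⟩ := h
  obtain ⟨l, Ls, h1, h2, rfl⟩ := List.map_eq_cons_iff.1 hM
  obtain ⟨p, l, rfl, hp, h2⟩ := List.map_eq_cons_iff.1 h2
  obtain rfl := List.map_eq_nil_iff.1 h2
  have hf := M.isFaceList
  rw [h1] at hf
  have hpp : M.face p = p := by simpa using hf.map_eq [p] (by simp)
  refine ⟨D, inferInstance, { M with
    vert := swap p (M.vert p) * M.vert
    faces := Ls
    planar := M.planar.detach hpp
    hol_vert := fun d => ?_
    isFaceList := ⟨by simpa using hf.nodup.of_append_right,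
      fun l hl => hf.map_eq l (List.mem_cons_of_mem _ hl), fun d hd => ?_⟩ }, rfl⟩
  · rw [Perm.mul_apply]
    by_cases hdp : d = p
    · subst hdp
      simp [hp, symX_zero]
    by_cases hdq : M.vert d = p
    · rw [hdq, swap_apply_left, M.hol_vert, ← M.hol_vert d, hdq, hp, symX_zero, mul_one]
    · rw [swap_apply_of_ne_of_ne hdq (M.vert.injective.ne hdp), M.hol_vert]
  · by_cases hdp : d = p
    · subst hdp
      simp [hpp]
    · obtain ⟨h3, h4⟩ := hf.fixed d (by simp [hdp] at hd ⊢; exact hd)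
      refine ⟨h3, ?_⟩
      have h5 : d ≠ M.vert p := fun h => hdp (M.vert.injective (h4.trans h))
      rw [Perm.mul_apply, h4, swap_apply_of_ne_of_ne hdp h5]

/-- Adjoin an isolated dart to a diagram. -/
def Diagram.extend {D : Type} [Finite D] (M : Diagram D) (g : Perm (Fin 3)) :
    Diagram (Option D) where
  face := optionCongr M.face
  vert := optionCongr M.vert
  lab o := o.elim (0, 0) M.lab
  hol o := o.elim g M.hol
  faces := [none] :: M.faces.map (List.map some)
  planar := M.planar.option
  hol_face := by
    rintro (_ | d)
    · simp [symX_zero, symY_zero]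
    · exact M.hol_face d
  hol_vert := by
    rintro (_ | d)
    · simp [symX_zero]
    · exact M.hol_vert d
  isFaceList := by
    refine ⟨?_, ?_, ?_⟩
    · simp only [List.flatten_cons, ← List.map_flatten, List.singleton_append, List.nodup_cons]
      exact ⟨by simp, M.isFaceList.nodup.map (Option.some_injective D)⟩
    · intro l hl
      rcases List.mem_cons.1 hl with rfl | hl
      · simp
      · obtain ⟨l, hl', rfl⟩ := List.mem_map.1 hl
        rw [← List.map_rotate, ← M.isFaceList.map_eq l hl']
        simp
    · rintro (_ | d) hd
      · simp
      · have := M.isFaceList.fixed d fun hc => hd (by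
          simpa [← List.map_flatten] using hc)
        simp [this]

theorem map_map_ite_extend {D β : Type} [DecidableEq D] {Ls : List (List D)} {q : D}
    (f : Option D → β) (s t : β) (hq : q ∉ Ls.flatten) :
    (Ls.map (List.map some)).map (List.map fun d => if d = none then s else if d = some q then t
      else f d) = Ls.map (List.map fun d => f (some d)) := by
  rw [map_map_ite_of_notMem]
  · simp
  · simp [← List.map_flatten]
  · simpa [← List.map_flatten] using hq

theorem Realizable.add_monogon {L : List (List (ZMod 2 × ZMod 3))}
    (h : Realizable L) : Realizable ([(0, 0)] :: L) := by
  obtain ⟨D, _, M, rfl⟩ := h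
  refine ⟨Option D, inferInstance, M.extend 1, ?_⟩
  simp [Diagram.extend, Function.comp_def]

theorem Realizable.expand_left {f₁ f₂ : ZMod 2} {e : ZMod 3} {w : List (ZMod 2 × ZMod 3)}
    {L : List (List (ZMod 2 × ZMod 3))} (h : Realizable (((f₁ + f₂, e) :: w) :: L)) :
    Realizable (((f₁, 0) :: (f₂, e) :: w) :: L) := by
  classical
  obtain ⟨D, _, M, hM⟩ := h
  obtain ⟨l, Ls, h1, h2, rfl⟩ := List.map_eq_cons_iff.1 hM
  obtain ⟨q, l, rfl, hq, rfl⟩ := List.map_eq_cons_iff.1 h2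
  let N := M.extend (M.hol q * symX f₁)
  have hf := N.isFaceList
  rw [show N.faces = [none] :: (some q :: l.map some) :: Ls.map (List.map some) by
    simp [N, Diagram.extend, h1]] at hf
  have hn := M.isFaceList.nodup
  rw [h1] at hn
  simp only [List.flatten_cons, List.nodup_append', List.nodup_cons] at hn
  obtain ⟨⟨hql, -⟩, -, hdisj⟩ := hn
  have hN1 : N.face none = none := rfl
  have hN2 : N.vert none = none := rfl
  have hN3 : N.hol none = M.hol q * symX f₁ := rfl
  have hN4 : N.hol (some q) = M.hol q := rfl
  have hN5 : N.lab none = (0, 0) := rfl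
  have hN6 : N.lab (some q) = (f₁ + f₂, e) := hq
  have hN7 : ∀ d, N.lab (some d) = M.lab d := fun _ => rfl
  have hne : (none : Option D) ≠ some q := by simp
  refine ⟨Option D, inferInstance,
    { face := swap none (some q) * N.face
      vert := N.vert * swap none (some q)
      lab := fun d => if d = none then (f₁, 0) else if d = some q then (f₂, e) else N.lab d
      hol := fun d => N.hol (swap none (some q) d)
      faces := (none :: some q :: l.map some) :: Ls.map (List.map some)
      planar := N.planar.insert_alpha hN1 hN2 hne
      hol_face := fun d => ?_
      hol_vert := fun d => ?_
      isFaceList := IsFaceList.merge (A := []) hf fun d h hp hq => by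
        rw [Perm.mul_apply, swap_apply_of_ne_of_ne hp hq, h] }, ?_⟩
  · rw [Perm.mul_apply, swap_apply_self, N.hol_face]
    by_cases hdp : d = none
    · subst hdp
      simp [hN3, hN4, hN5, symX_zero, symY_zero]
    by_cases hdq : d = some q
    · subst hdq
      simp [hN3, hN4, hN6, symX_add, mul_assoc]
    · simp [hdp, hdq, swap_apply_of_ne_of_ne]
  · rw [Perm.mul_apply, ← N.hol_vert (swap none (some q) d)]
    generalize N.vert (swap none (some q) d) = c
    by_cases hdp : c = none
    · subst hdp
      simp [hN3, hN4, hN5, symX_zero]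
    by_cases hdq : c = some q
    · subst hdq
      simp [hN3, hN4, hN6, symX_add, mul_assoc]
    · simp [hdp, hdq, swap_apply_of_ne_of_ne]
  · have hqL : q ∉ Ls.flatten := fun h => hdisj (by simp) h
    have h3 := map_ite_of_notMem (l := l.map some) (p := none) (q := some q) N.lab (f₁, 0) (f₂, e)
      (by simp) (by simpa using hql)
    rw [List.map_cons, List.map_cons, List.map_cons, map_map_ite_extend _ _ _ hqL, h3]
    simp [hN7, Function.comp_def]

theorem Realizable.expand_right {f : ZMod 2} {e₁ e₂ : ZMod 3} {w : List (ZMod 2 × ZMod 3)}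
    {L : List (List (ZMod 2 × ZMod 3))} (h : Realizable ((w ++ [(f, e₁ + e₂)]) :: L)) :
    Realizable (((0, e₂) :: (w ++ [(f, e₁)])) :: L) := by
  classical
  obtain ⟨D, _, M, hM⟩ := h
  obtain ⟨l, Ls, h1, h2, rfl⟩ := List.map_eq_cons_iff.1 hM
  obtain ⟨l, l', rfl, rfl, h3⟩ := List.map_eq_append_iff.1 h2
  obtain ⟨q, l', rfl, hq, h3⟩ := List.map_eq_cons_iff.1 h3
  obtain rfl := List.map_eq_nil_iff.1 h3
  obtain ⟨c, C, hC⟩ : ∃ c C, l ++ [q] = c :: C := by cases l <;> simp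
  have hqc : M.face q = c := by
    have hm := M.isFaceList.map_eq (l ++ [q]) (by simp [h1])
    rw [List.map_append, hC, List.rotate_cons_succ, List.rotate_zero] at hm
    have := (List.append_inj' hm (by simp)).2
    simpa using this
  let N := M.extend (M.hol c * symY (-e₂))
  have hf := N.isFaceList
  rw [show N.faces = [none] :: (some c :: C.map some) :: Ls.map (List.map some) by
    simp [N, Diagram.extend, h1, hC]] at hf
  have hn := M.isFaceList.nodup
  rw [h1] at hn
  simp only [List.flatten_cons, List.nodup_append', List.disjoint_singleton] at hn
  obtain ⟨⟨-, -, hql⟩, -, hdisj⟩ := hn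
  have hN1 : N.face none = none := rfl
  have hN2 : N.vert none = none := rfl
  have hN3 : N.hol none = M.hol c * symY (-e₂) := rfl
  have hN4 : N.hol (some c) = M.hol c := rfl
  have hN5 : N.lab none = (0, 0) := rfl
  have hN6 : N.lab (some q) = (f, e₁ + e₂) := hq
  have hN7 : ∀ d, N.lab (some d) = M.lab d := fun _ => rfl
  have hN8 : N.face (some q) = some c := congrArg some hqc
  have hN9 : N.hol (some c) = N.hol (some q) * symX f * symY (e₁ + e₂) := by
    rw [← hN8, N.hol_face, hN6]
  have hne : (none : Option D) ≠ some c := by simp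
  refine ⟨Option D, inferInstance,
    { face := swap none (some c) * N.face
      vert := N.vert
      lab := fun d => if d = none then (0, e₂) else if d = some q then (f, e₁) else N.lab d
      hol := N.hol
      faces := (none :: some c :: C.map some) :: Ls.map (List.map some)
      planar := N.planar.insert_beta hN1 hN2 hne
      hol_face := fun d => ?_
      hol_vert := fun d => ?_
      isFaceList := IsFaceList.merge (A := []) hf fun d h hp hq => h }, ?_⟩
  · rw [Perm.mul_apply]
    by_cases hdp : d = none
    · subst hdp
      simp [hN1, hN3, hN4, symX_zero, mul_assoc, ← symY_add, symY_zero]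
    by_cases hdq : d = some q
    · subst hdq
      rw [hN8, swap_apply_right, hN3, ← hN4, hN9]
      simp [mul_assoc, ← symY_add]
    · have h3 : N.face d ≠ none := by
        rw [← hN1, N.face.injective.ne_iff]
        exact hdp
      have h4 : N.face d ≠ some c := by
        rw [← hN8, N.face.injective.ne_iff]
        exact hdq
      simp [hdp, hdq, swap_apply_of_ne_of_ne h3 h4, N.hol_face]
  · rw [← N.hol_vert d]
    generalize N.vert d = c
    by_cases hdp : c = none
    · subst hdp
      simp [hN5]
    by_cases hdq : c = some q
    · subst hdq
      simp [hN6]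
    · simp [hdp, hdq]
  · have hqL : q ∉ Ls.flatten := fun h => hdisj (by simp) h
    have hql' : q ∉ l := fun h => hql h
    have h3 := map_ite_of_notMem (l := l.map some) (p := none) (q := some q) N.lab (0, e₂) (f, e₁)
      (by simp) (by simpa using hql')
    have h4 : some c :: C.map some = l.map some ++ [some q] := by
      rw [← List.map_cons, ← hC]
      simp
    dsimp only
    rw [List.map_cons, List.map_cons, map_map_ite_extend _ _ _ hqL, h4, List.map_append, h3]
    simp [hN7, Function.comp_def]

theorem Diagram.realizable_merge {D : Type} [Finite D] (M : Diagram D) {p q : D} {A B : List D}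
    {Ls : List (List D)} (hL : M.faces = (p :: A) :: (q :: B) :: Ls) (hpq : M.vert p = q)
    (hqp : M.vert q = p) :
    Realizable (((0, (M.lab p).2) :: A.map M.lab ++ (0, (M.lab q).2) :: B.map M.lab) ::
      Ls.map (List.map M.lab)) := by
  classical
  have hf := M.isFaceList
  rw [hL] at hf
  have hn := hf.nodup
  simp only [List.flatten_cons, List.nodup_append', List.nodup_cons, List.cons_append,
    List.mem_append, List.mem_cons, not_or,
    List.disjoint_append_right, List.disjoint_cons_right] at hn
  have hs : ¬ M.face.SameCycle p q := by
    intro hc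
    have := sameCycle_mem_of_forall (B := {d | d ∈ p :: A})
      (fun d hd => M.face_mem (l := p :: A) (by simp [hL]) hd) hc (by simp)
    simp at this
    tauto
  have hα : M.vert.SameCycle p q := hpq ▸ Perm.sameCycle_apply_right.2 (Perm.SameCycle.refl _ _)
  have hp1 := M.hol_vert q
  have hq1 := M.hol_vert p
  rw [hqp] at hp1
  rw [hpq] at hq1
  refine ⟨D, inferInstance,
    { face := swap p q * M.face
      vert := M.vert * swap p q
      lab := fun d => if d = p then (0, (M.lab p).2) else if d = q then (0, (M.lab q).2)
        else M.lab d
      hol := fun d => M.hol (swap p q d)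
      faces := (p :: A ++ q :: B) :: Ls
      planar := M.planar.merge hs hα
      hol_face := fun d => ?_
      hol_vert := fun d => ?_
      isFaceList := hf.merge fun d h hp hq => by
        rw [Perm.mul_apply, swap_apply_of_ne_of_ne hp hq, h] }, ?_⟩
  · rw [Perm.mul_apply, swap_apply_self, M.hol_face]
    by_cases hdp : d = p
    · subst hdp
      simp [hp1, symX_zero]
    by_cases hdq : d = q
    · subst hdq
      simp [hdp, hq1, symX_zero]
    · simp [hdp, hdq, swap_apply_of_ne_of_ne]
  · rw [Perm.mul_apply, ← M.hol_vert (swap p q d)]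
    generalize M.vert (swap p q d) = c
    by_cases hdp : c = p
    · subst hdp
      simp [hp1, symX_zero]
    by_cases hdq : c = q
    · subst hdq
      simp [hdp, hq1, symX_zero]
    · simp [hdp, hdq, swap_apply_of_ne_of_ne]
  · have h3 := map_map_ite_of_notMem (Ls := Ls) (p := p) (q := q) M.lab (0, (M.lab p).2)
      (0, (M.lab q).2) (by tauto) (by tauto)
    have h4 := map_ite_of_notMem (l := A) (p := p) (q := q) M.lab (0, (M.lab p).2)
      (0, (M.lab q).2) (by tauto) (by tauto)
    have h5 := map_ite_of_notMem (l := B) (p := p) (q := q) M.lab (0, (M.lab p).2)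
      (0, (M.lab q).2) (by tauto) (by tauto)
    have h6 : q ≠ p := by rintro rfl; tauto
    simp only [List.map_cons, List.map_append, h3, h4, h5, if_true, if_neg h6]

/-- Words that can be exchanged in the face words of a diagram. -/
def wordCon : Con (FreeMonoid (ZMod 2 × ZMod 3)) where
  r w w' := ∀ u v L, Realizable ((u ++ w.toList ++ v) :: L) ↔ Realizable ((u ++ w'.toList ++ v) :: L)
  iseqv := ⟨fun _ _ _ _ => Iff.rfl, fun h u v L => (h u v L).symm,
    fun h h' u v L => (h u v L).trans (h' u v L)⟩
  mul' {w w' z z'} h h' u v L := by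
    have h1 := h u (z.toList ++ v) L
    have h2 := h' (u ++ w'.toList) v L
    simp only [FreeMonoid.toList_mul, List.append_assoc] at *
    exact h1.trans h2

/-- The class of a word up to exchange in diagrams. -/
def wordClass (w : List (ZMod 2 × ZMod 3)) : wordCon.Quotient := (FreeMonoid.ofList w : _)

theorem wordClass_append (u v : List (ZMod 2 × ZMod 3)) :
    wordClass (u ++ v) = wordClass u * wordClass v := by
  simp [wordClass, FreeMonoid.ofList_append]

theorem wordClass_nil : wordClass [] = 1 := rfl

theorem wordClass_surjective : Function.Surjective wordClass := by
  intro q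
  induction q using Con.induction_on with
  | _ w => exact ⟨w.toList, rfl⟩

theorem wordClass_eq_iff {w w' : List (ZMod 2 × ZMod 3)} : wordClass w = wordClass w' ↔
    ∀ u v L, Realizable ((u ++ w ++ v) :: L) ↔ Realizable ((u ++ w' ++ v) :: L) :=
  (Con.eq wordCon)

theorem realizable_cons_congr {w w' : List (ZMod 2 × ZMod 3)} (h : wordClass w = wordClass w')
    (L : List (List (ZMod 2 × ZMod 3))) : Realizable (w :: L) ↔ Realizable (w' :: L) := by
  simpa using wordClass_eq_iff.1 h [] [] L

theorem wordClass_eq_of_forall {w w' : List (ZMod 2 × ZMod 3)}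
    (h : ∀ v L, Realizable ((w ++ v) :: L) ↔ Realizable ((w' ++ v) :: L)) :
    wordClass w = wordClass w' := by
  refine wordClass_eq_iff.2 fun u v L => ⟨fun hr => ?_, fun hr => ?_⟩
  · rw [List.append_assoc] at hr ⊢
    have := hr.rotate
    rw [List.append_assoc, h, ← List.append_assoc] at this
    exact this.rotate
  · rw [List.append_assoc] at hr ⊢
    have := hr.rotate
    rw [List.append_assoc, ← h, ← List.append_assoc] at this
    exact this.rotate

theorem wordClass_left (f₁ f₂ : ZMod 2) (e : ZMod 3) :
    wordClass [(f₁, 0), (f₂, e)] = wordClass [(f₁ + f₂, e)] :=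
  wordClass_eq_of_forall fun _ _ => ⟨fun h => h.contract_left.remove_monogon, fun h => h.expand_left⟩

theorem wordClass_right (f : ZMod 2) (e₁ e₂ : ZMod 3) :
    wordClass [(f, e₁), (0, e₂)] = wordClass [(f, e₁ + e₂)] := by
  refine wordClass_eq_of_forall fun v L => ⟨fun h => ?_, fun h => ?_⟩
  · have h1 : Realizable (((0, e₂) :: (v ++ [(f, e₁)])) :: L) :=
      Realizable.rotate (u := [(f, e₁)]) (v := (0, e₂) :: v) h
    exact Realizable.rotate h1.contract_right.remove_monogon
  · have h1 : Realizable ((v ++ [(f, e₁ + e₂)]) :: L) := Realizable.rotate h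
    exact Realizable.rotate (u := (0, e₂) :: v) (v := [(f, e₁)]) (by simpa using h1.expand_right)

theorem wordClass_zero : wordClass [(0, 0)] = 1 := by
  refine wordClass_eq_of_forall fun v L => ?_
  rcases v with _ | ⟨⟨f, e⟩, v⟩
  · exact ⟨fun h => realizable_nil_cons.2 h.remove_monogon,
      fun h => (realizable_nil_cons.1 h).add_monogon⟩
  · have := wordClass_eq_iff.1 (wordClass_left 0 f e) [] v L
    simpa using this

/-- The class of `x` as a unit. -/
def unitX : wordCon.Quotientˣ where
  val := wordClass [(1, 0)]
  inv := wordClass [(1, 0)]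
  val_inv := by rw [← wordClass_append, ← wordClass_zero]; exact wordClass_left 1 1 0
  inv_val := by rw [← wordClass_append, ← wordClass_zero]; exact wordClass_left 1 1 0

/-- The class of `y` as a unit. -/
def unitY : wordCon.Quotientˣ where
  val := wordClass [(0, 1)]
  inv := wordClass [(0, 2)]
  val_inv := by rw [← wordClass_append, ← wordClass_zero]; exact wordClass_right 0 1 2
  inv_val := by rw [← wordClass_append, ← wordClass_zero]; exact wordClass_right 0 2 1

theorem unitX_mul_self : unitX * unitX = 1 := Units.ext unitX.val_inv

theorem unitY_pow (e : ZMod 3) : ((unitY ^ e.val : wordCon.Quotientˣ) : wordCon.Quotient) =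
    wordClass [(0, e)] := by
  fin_cases e
  · exact wordClass_zero.symm
  · exact pow_one _
  · change ((unitY ^ 2 : wordCon.Quotientˣ) : wordCon.Quotient) = wordClass [(0, 2)]
    rw [pow_two, Units.val_mul, unitY, ← wordClass_append]
    exact wordClass_right 0 1 1

/-- The homomorphism from the free group on `x` and `y` to the units of the word classes. -/
def wordUnits : F →* wordCon.Quotientˣ := FreeGroup.lift ![unitX, unitY]

/-- The element `∏ x * y ^ e` of the free group. -/
def signElt (es : List (ZMod 3)) : F := (es.map fun e => x * y ^ e.val).prod

/-- The word with syllables `x * y ^ e`. -/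
def signWord (es : List (ZMod 3)) : List (ZMod 2 × ZMod 3) := es.map fun e => (1, e)

/-- The list of exponents of the inverse word. -/
def mirror (es : List (ZMod 3)) : List (ZMod 3) := (es.map fun e => -e).reverse

theorem wordUnits_x : wordUnits x = unitX := by simp [wordUnits, x]
theorem wordUnits_y : wordUnits y = unitY := by simp [wordUnits, y]

theorem wordUnits_signElt (es : List (ZMod 3)) :
    (wordUnits (signElt es) : wordCon.Quotient) = wordClass (signWord es) := by
  induction es with
  | nil => simp [signElt, signWord, wordClass_nil]
  | cons e es ih =>
    have h1 : signElt (e :: es) = x * y ^ e.val * signElt es := by simp [signElt]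
    have h2 : signWord (e :: es) = [(1, e)] ++ signWord es := rfl
    rw [h1, h2, wordClass_append, map_mul, Units.val_mul, ih, map_mul, map_pow, wordUnits_x, wordUnits_y,
      Units.val_mul, unitY_pow, unitX, ← wordClass_append, List.singleton_append, wordClass_left]
    simp

theorem unitY_pow_three : unitY ^ 3 = 1 := by
  have h : unitY ^ 2 = unitY⁻¹ := Units.ext (unitY_pow 2)
  rw [pow_succ, h, inv_mul_cancel]

theorem unitY_pow_neg (e : ZMod 3) : unitY ^ e.val * unitY ^ (-e).val = 1 := by
  rw [← pow_add]
  fin_cases e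
  · rfl
  · exact unitY_pow_three
  · exact unitY_pow_three

theorem signWord_mul_mirror (es : List (ZMod 3)) : wordClass (signWord es) * wordClass [(1, 0)] *
    wordClass (signWord (mirror es)) * wordClass [(1, 0)] = 1 := by
  suffices h : wordUnits (signElt es) * unitX * wordUnits (signElt (mirror es)) * unitX = 1 by
    have h' := congrArg Units.val h
    simp only [Units.val_mul, wordUnits_signElt] at h'
    exact h'
  induction es with
  | nil => simpa [signElt, mirror] using unitX_mul_self
  | cons e es ih =>
    have h1 : signElt (e :: es) = x * y ^ e.val * signElt es := by simp [signElt]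
    have h2 : signElt (mirror (e :: es)) = signElt (mirror es) * (x * y ^ (-e).val) := by
      simp [signElt, mirror]
    rw [h1, h2]
    simp only [map_mul, map_pow, wordUnits_x, wordUnits_y]
    calc _ = unitX * unitY ^ e.val * (wordUnits (signElt es) * unitX * wordUnits (signElt (mirror es)) *
        unitX) * unitY ^ (-e).val * unitX := by group
      _ = unitX * (unitY ^ e.val * unitY ^ (-e).val) * unitX := by rw [ih]; group
      _ = 1 := by rw [unitY_pow_neg, mul_one, unitX_mul_self]

/-- The exponents of the relator `W22 ^ 2`. -/
def relList : List (ZMod 3) :=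
  [1, 1, 1, 1, 2, 2, 2, 1, 1, 2, 2, 2, 1, 2, 2, 1, 1, 1, 1, 2, 2, 2, 1, 1, 2, 2, 2, 1, 2, 2]

theorem signElt_relList : signElt relList = W22 ^ 2 := by
  simp only [signElt, relList, W22, List.map_cons, List.map_nil, List.prod_cons, List.prod_nil,
    show (1 : ZMod 3).val = 1 from rfl, show (2 : ZMod 3).val = 2 from rfl, pow_succ, pow_zero,
    one_mul, mul_one, mul_assoc]

/-- The relator words: the exponents of `W22 ^ 2` and of its inverse. -/
def IsCell (c : List (ZMod 2 × ZMod 3)) : Prop :=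
  c = signWord relList ∨ c = signWord (mirror relList)

theorem IsCell.symEval {c : List (ZMod 2 × ZMod 3)} (h : IsCell c) : symEval c = 1 := by
  rcases h with rfl | rfl <;> decide +kernel

/-- `w` is the boundary word of a planar diagram of relator cells. -/
def HasDiagram (w : List (ZMod 2 × ZMod 3)) : Prop :=
  ∃ cs, (∀ c ∈ cs, IsCell c) ∧ Realizable (w :: cs)

theorem HasDiagram.congr {w w' : List (ZMod 2 × ZMod 3)} (h : HasDiagram w)
    (hw : wordClass w = wordClass w') : HasDiagram w' :=
  let ⟨cs, h1, h2⟩ := h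
  ⟨cs, h1, (realizable_cons_congr hw cs).1 h2⟩

theorem HasDiagram.rotate {u v : List (ZMod 2 × ZMod 3)} (h : HasDiagram (u ++ v)) :
    HasDiagram (v ++ u) :=
  let ⟨cs, h1, h2⟩ := h
  ⟨cs, h1, h2.rotate⟩

theorem HasDiagram.split {u v : List (ZMod 2 × ZMod 3)} (h : HasDiagram (u ++ v)) (hu : IsCell u) :
    HasDiagram v := by
  obtain ⟨cs, h1, h2⟩ := h
  refine ⟨u :: cs, ?_, (h2.split hu.symEval).perm (List.Perm.swap _ _ _)⟩
  simpa using ⟨hu, h1⟩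

/-- The diagram without darts. -/
def emptyDiagram : Diagram Empty where
  face := 1
  vert := 1
  lab := Empty.elim
  hol := Empty.elim
  faces := []
  planar := by
    have : IsEmpty (Quot fun a b : Empty => (1 : Perm Empty) a = b ∨ (1 : Perm Empty) a = b) :=
      ⟨fun q => Quot.ind (β := fun _ => False) (fun a => a.elim) q⟩
    rw [IsPlanar, componentCount, classCount, Nat.card_of_isEmpty, Nat.card_of_isEmpty]
    exact Nat.zero_le _
  hol_face := by simp
  hol_vert := by simp
  isFaceList := ⟨by simp, by simp, by simp⟩

theorem hasDiagram_nil : HasDiagram [] :=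
  ⟨[], by simp, realizable_nil_cons.2 ⟨Empty, inferInstance, emptyDiagram, rfl⟩⟩

/-- `HasDiagram` as a property of word classes. -/
def ClassHasDiagram (q : wordCon.Quotient) : Prop := ∃ w, wordClass w = q ∧ HasDiagram w

theorem classHasDiagram_wordClass {w : List (ZMod 2 × ZMod 3)} :
    ClassHasDiagram (wordClass w) ↔ HasDiagram w :=
  ⟨fun ⟨_, h1, h2⟩ => h2.congr h1, fun h => ⟨w, rfl, h⟩⟩

theorem ClassHasDiagram.rotate {p q : wordCon.Quotient} (h : ClassHasDiagram (p * q)) :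
    ClassHasDiagram (q * p) := by
  obtain ⟨u, rfl⟩ := wordClass_surjective p
  obtain ⟨v, rfl⟩ := wordClass_surjective q
  rw [← wordClass_append, classHasDiagram_wordClass] at h ⊢
  exact h.rotate

theorem ClassHasDiagram.split {q : wordCon.Quotient} {c : List (ZMod 2 × ZMod 3)}
    (h : ClassHasDiagram (wordClass c * q)) (hc : IsCell c) : ClassHasDiagram q := by
  obtain ⟨v, rfl⟩ := wordClass_surjective q
  rw [← wordClass_append, classHasDiagram_wordClass] at h
  exact classHasDiagram_wordClass.2 (h.split hc)

theorem classHasDiagram_conj (u : wordCon.Quotientˣ) (q : wordCon.Quotient) :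
    ClassHasDiagram (u * q * (u⁻¹ : wordCon.Quotientˣ)) ↔ ClassHasDiagram q := by
  refine ⟨fun h => ?_, fun h => ?_⟩
  · simpa [← mul_assoc] using h.rotate
  · apply ClassHasDiagram.rotate
    simpa [← mul_assoc] using h

theorem classHasDiagram_mul_relList (q : wordCon.Quotient) :
    ClassHasDiagram (q * wordClass (signWord relList)) ↔ ClassHasDiagram q := by
  refine ⟨fun h => h.rotate.split (.inl rfl), fun h => ?_⟩
  have h1 : ClassHasDiagram (q * wordClass (signWord relList) * wordClass [(1, 0)] *
      wordClass (signWord (mirror relList)) * wordClass [(1, 0)]) := by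
    have := signWord_mul_mirror relList
    rw [show q * wordClass (signWord relList) * wordClass [(1, 0)] *
      wordClass (signWord (mirror relList)) * wordClass [(1, 0)] = q * (wordClass (signWord relList) *
      wordClass [(1, 0)] * wordClass (signWord (mirror relList)) * wordClass [(1, 0)]) by
        simp only [mul_assoc], this, mul_one]
    exact h
  rw [mul_assoc] at h1
  have h2 := h1.rotate
  rw [mul_assoc] at h2
  have h3 := (h2.split (.inr rfl)).rotate
  have h4 : wordClass [(1, 0)] * wordClass [(1, 0)] = 1 := unitX.val_inv
  rwa [mul_assoc, h4, mul_one] at h3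

/-- The elements whose action preserves the classes of boundary words of diagrams. -/
def diagramSubgroup : Subgroup F where
  carrier := {n | ∀ q, ClassHasDiagram (q * wordUnits n) ↔ ClassHasDiagram q}
  one_mem' q := by simp
  mul_mem' {a b} ha hb q := by
    rw [map_mul, Units.val_mul, ← mul_assoc, hb, ha]
  inv_mem' {a} ha q := by
    rw [← ha, map_inv, Units.inv_mul_cancel_right]

theorem diagramSubgroup_normal : diagramSubgroup.Normal where
  conj_mem n hn g q := by
    have h1 := hn ((wordUnits g)⁻¹ * q * (wordUnits g))
    rw [← classHasDiagram_conj (wordUnits g), ← classHasDiagram_conj (wordUnits g) (_ * q * _)] at h1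
    simpa [mul_assoc] using h1

theorem HasDiagram.of_mem_normalClosure {n : F} (hn : n ∈ Subgroup.normalClosure (rels W22))
    {w : List (ZMod 2 × ZMod 3)} (hw : wordClass w = wordUnits n) : HasDiagram w := by
  have := diagramSubgroup_normal
  have hle : Subgroup.normalClosure (rels W22) ≤ diagramSubgroup := by
    refine Subgroup.normalClosure_le_normal ?_
    intro r hr q
    rcases hr with rfl | rfl | rfl
    · rw [map_pow, wordUnits_x, pow_two, unitX_mul_self, Units.val_one, mul_one]
    · rw [map_pow, wordUnits_y, unitY_pow_three, Units.val_one, mul_one]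
    · rw [← signElt_relList, wordUnits_signElt]
      exact classHasDiagram_mul_relList q
  rw [← classHasDiagram_wordClass, hw, ← one_mul (wordUnits n : wordCon.Quotient), hle hn,
    ← wordClass_nil, classHasDiagram_wordClass]
  exact hasDiagram_nil

theorem hasDiagram_of_mk_eq_one {es : List (ZMod 3)} (h : mk W22 (signElt es) = 1) :
    HasDiagram (signWord es) :=
  .of_mem_normalClosure (PresentedGroup.mk_eq_one_iff.1 h) (wordUnits_signElt es).symm

theorem List.map_iterate_of_map_eq {D : Type} {f : D → D} {l : List D} (h : l.map f = l.rotate 1)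
    (t : ℕ) : l.map f^[t] = l.rotate t := by
  induction t with
  | zero => simp
  | succ t ih =>
    rw [Function.iterate_succ, ← List.map_map, h, List.map_rotate, ih, List.rotate_rotate]

theorem List.rotate_eq_iterate_of_map_eq {D : Type} {f : D → D} {l : List D}
    (h : l.map f = l.rotate 1) {n : ℕ} (hn : n < l.length) :
    l.rotate n = List.iterate f l[n] l.length := by
  refine List.ext_getElem (by simp) fun t h1 h2 => ?_
  have h3 : (l.map f^[t])[n]'(by simpa) = f^[t] l[n] := by simp
  rw [List.getElem_iterate, ← h3, List.getElem_of_eq (map_iterate_of_map_eq h t),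
    List.getElem_rotate, List.getElem_rotate]
  simp [Nat.add_comm]

namespace IsFaceList
variable {D : Type} {φ α : Perm D} {Ls : List (List D)} {l : List D} {p : D}

theorem exists_rotate_eq (h : l.map φ = l.rotate 1) (hp : p ∈ l) :
    ∃ n, n < l.length ∧ l.rotate n = List.iterate φ p l.length := by
  obtain ⟨n, hn, rfl⟩ := List.mem_iff_getElem.1 hp
  exact ⟨n, hn, List.rotate_eq_iterate_of_map_eq h hn⟩

theorem iterate_head (h : IsFaceList φ α (l :: Ls)) (hp : p ∈ l) :
    IsFaceList φ α (List.iterate φ p l.length :: Ls) := by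
  obtain ⟨n, hn, hr⟩ := exists_rotate_eq (h.map_eq l (by simp)) hp
  rw [← hr, List.rotate_eq_drop_append_take hn.le]
  apply IsFaceList.rotate
  rwa [List.take_append_drop]

end IsFaceList

theorem wordClass_merge {a b : ZMod 3} {α β : List (ZMod 3)} (h : b :: β = mirror (a :: α)) :
    wordClass ((0, a) :: signWord α ++ (0, b) :: signWord β) = 1 := by
  have h1 (c : ZMod 3) (γ : List (ZMod 3)) : wordClass ((0, c) :: signWord γ) =
      wordClass [(1, 0)] * wordClass (signWord (c :: γ)) := by
    rw [← wordClass_append]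
    have := wordClass_left 1 1 c
    have h2 : (1 : ZMod 2) + 1 = 0 := rfl
    rw [h2] at this
    change wordClass ([(0, c)] ++ signWord γ) = wordClass ([(1, 0), (1, c)] ++ signWord γ)
    rw [wordClass_append, wordClass_append, this]
  have h2 := signWord_mul_mirror (a :: α)
  rw [wordClass_append, h1, h1, h]
  rw [← wordUnits_signElt, ← wordUnits_signElt] at h2 ⊢
  have h3 : wordClass [(1, 0)] = unitX := rfl
  rw [h3] at h2 ⊢
  rw [← Units.val_mul, ← Units.val_mul, ← Units.val_mul, Units.val_eq_one] at h2 ⊢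
  rw [← mul_assoc]
  calc _ = unitX * (wordUnits (signElt (a :: α)) * unitX * wordUnits (signElt (mirror (a :: α))) *
        unitX) * unitX⁻¹ := by group
    _ = 1 := by rw [h2]; group

theorem Diagram.reduce {D : Type} [Finite D] (M : Diagram D) {l₀ l₁ l₂ : List D}
    {Ls : List (List D)} (hf : M.faces.Perm (l₀ :: l₁ :: l₂ :: Ls)) {p q : D} (hp : p ∈ l₁)
    (hq : q ∈ l₂) (hpq : M.vert p = q) (hqp : M.vert q = p) {es : List (ZMod 3)}
    (h₁ : (List.iterate M.face p l₁.length).map M.lab = signWord es)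
    (h₂ : (List.iterate M.face q l₂.length).map M.lab = signWord (mirror es)) :
    Realizable (l₀.map M.lab :: Ls.map (List.map M.lab)) := by
  have h3 := ((M.isFaceList.perm (hf.trans (List.perm_middle (l₁ := [l₀, l₁]) (a := l₂)))).iterate_head
    hq).perm (List.perm_middle (l₁ := [_, l₀]) (a := l₁))
  have h4 := h3.iterate_head hp
  obtain ⟨n₁, hn₁⟩ := Nat.exists_eq_add_one_of_ne_zero (List.length_pos_of_mem hp).ne'
  obtain ⟨n₂, hn₂⟩ := Nat.exists_eq_add_one_of_ne_zero (List.length_pos_of_mem hq).ne'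
  rw [hn₁, List.iterate] at h₁ h4
  rw [hn₂, List.iterate] at h₂ h4
  have h5 := Diagram.realizable_merge { M with faces := _, isFaceList := h4 } rfl hpq hqp
  rcases es with _ | ⟨a, es⟩
  · simp [signWord] at h₁
  obtain ⟨b, fs, hb⟩ : ∃ b fs, mirror (a :: es) = b :: fs := by
    cases hm : mirror (a :: es) with
    | nil => simp [mirror] at hm
    | cons b fs => exact ⟨b, fs, rfl⟩
  rw [hb] at h₂
  simp only [signWord, List.map_cons, List.cons.injEq] at h₁ h₂
  simp only [h₁, h₂] at h5
  have h6 := (realizable_cons_congr (wordClass_merge hb.symm) _).1 h5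
  exact realizable_nil_cons.1 h6

section Count
variable {D : Type} [Fintype D] [DecidableEq D]

/-- Six times the share of a dart in its cycle, bounded above by two for cycles of length at
least three. -/
def cycleShare (σ : Perm D) (d : D) : ℕ :=
  if σ d = d then 6 else if σ (σ d) = d then 3 else 2

omit [Fintype D] in
theorem two_le_cycleShare (σ : Perm D) (d : D) : 2 ≤ cycleShare σ d := by
  unfold cycleShare
  split_ifs <;> omega

theorem six_mul_cycleCount_le (σ : Perm D) : 6 * cycleCount σ ≤ ∑ d, cycleShare σ d := by
  classical
  let π : D → Quot fun a b => σ a = b := Quot.mk _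
  have : Fintype (Quot fun a b => σ a = b) := Fintype.ofSurjective π Quot.mk_surjective
  have hπ (d : D) : π (σ d) = π d := (Quot.sound (r := fun a b => σ a = b) rfl).symm
  rw [cycleCount, classCount, Nat.card_eq_fintype_card, ← Finset.sum_fiberwise Finset.univ π, mul_comm,
    ← smul_eq_mul, ← Finset.card_univ]
  refine Finset.card_nsmul_le_sum _ _ _ fun q _ => ?_
  obtain ⟨d, rfl⟩ := Quot.exists_rep q
  by_cases h1 : σ d = d
  · calc 6 = ∑ i ∈ {d}, cycleShare σ i := by simp [cycleShare, h1]
      _ ≤ _ := Finset.sum_le_sum_of_subset (by simp [π])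
  by_cases h2 : σ (σ d) = d
  · calc 6 = ∑ i ∈ {d, σ d}, cycleShare σ i := by
          rw [Finset.sum_pair (Ne.symm h1)]
          simp [cycleShare, h1, h2, Ne.symm h1]
      _ ≤ _ := Finset.sum_le_sum_of_subset (by simp [Finset.insert_subset_iff, π, ← hπ d])
  · have h3 : σ d ≠ σ (σ d) := fun h => h1 (σ.injective h).symm
    calc 6 = ({d, σ d, σ (σ d)} : Finset D).card • 2 := by
          rw [Finset.card_eq_three.2 ⟨_, _, _, Ne.symm h1, Ne.symm h2, h3, rfl⟩, smul_eq_mul]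
      _ ≤ ∑ i ∈ {d, σ d, σ (σ d)}, cycleShare σ i :=
          Finset.card_nsmul_le_sum _ _ _ fun i _ => two_le_cycleShare σ i
      _ ≤ _ := Finset.sum_le_sum_of_subset (by
          have := (hπ (σ d)).trans (hπ d)
          simp only [Finset.insert_subset_iff, Finset.mem_filter, Finset.mem_univ, true_and,
            Finset.singleton_subset_iff]
          exact ⟨rfl, hπ d, this⟩)

end Count

namespace IsFaceList
variable {D : Type} {φ α : Perm D} {Ls : List (List D)}

theorem cycleCount_le [Finite D] (h : IsFaceList φ α Ls) (hne : [] ∉ Ls) :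
    cycleCount φ ≤ Nat.card {d // d ∉ Ls.flatten} + Ls.length := by
  have hpos (i : Fin Ls.length) : 0 < Ls[i].length :=
    List.length_pos_of_ne_nil fun h0 => hne (h0 ▸ List.getElem_mem _)
  let f : {d // d ∉ Ls.flatten} ⊕ Fin Ls.length → Quot fun a b => φ a = b :=
    Sum.elim (fun d => Quot.mk _ d.1) (fun i => Quot.mk _ (Ls[i][0]'(hpos i)))
  have hf : Function.Surjective f := by
    intro q
    obtain ⟨d, rfl⟩ := Quot.exists_rep q
    by_cases hd : d ∈ Ls.flatten
    · obtain ⟨l, hl, hdl⟩ := List.mem_flatten.1 hd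
      obtain ⟨i, hi, rfl⟩ := List.mem_iff_getElem.1 hl
      have h1 := List.rotate_eq_iterate_of_map_eq (h.map_eq _ hl) (hpos ⟨i, hi⟩)
      rw [List.rotate_zero] at h1
      rw [h1] at hdl
      obtain ⟨m, -, rfl⟩ := List.mem_iterate.1 hdl
      refine ⟨.inr ⟨i, hi⟩, ?_⟩
      change Quot.mk _ _ = Quot.mk _ _
      rw [Quot.eq, eqvGen_perm_iff, ← Perm.coe_pow]
      exact Perm.sameCycle_pow_right.2 (Perm.SameCycle.refl _ _)
    · exact ⟨.inl ⟨d, hd⟩, rfl⟩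
  calc cycleCount φ ≤ Nat.card ({d // d ∉ Ls.flatten} ⊕ Fin Ls.length) :=
        Nat.card_le_card_of_surjective f hf
    _ = _ := by rw [Nat.card_sum, Nat.card_fin]

theorem lt_componentCount [Finite D] (h : IsFaceList φ α Ls) {d₀ : D} (hd₀ : d₀ ∈ Ls.flatten) :
    Nat.card {d // d ∉ Ls.flatten} < componentCount φ α := by
  classical
  let f : (Quot fun a b => φ a = b ∨ α a = b) → Option {d // d ∉ Ls.flatten} :=
    Quot.lift (fun d => if hd : d ∉ Ls.flatten then some ⟨d, hd⟩ else none) (by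
      intro a b hab
      by_cases ha : a ∉ Ls.flatten
      · obtain ⟨h1, h2⟩ := h.fixed a ha
        obtain rfl : a = b := by rcases hab with rfl | rfl <;> simp [h1, h2]
        rfl
      by_cases hb : b ∉ Ls.flatten
      · obtain ⟨h1, h2⟩ := h.fixed b hb
        obtain rfl : a = b := by
          rcases hab with hab | hab
          · exact φ.injective (hab.trans h1.symm)
          · exact α.injective (hab.trans h2.symm)
        rfl
      · rw [dif_neg ha, dif_neg hb])
  have hf : Function.Surjective f := by
    rintro (_ | ⟨d, hd⟩)
    · exact ⟨Quot.mk _ d₀, by simp [f, hd₀]⟩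
    · exact ⟨Quot.mk _ d, by simp [f, hd]⟩
  have := Nat.card_le_card_of_surjective f hf
  rwa [Finite.card_option] at this

end IsFaceList

theorem Diagram.twelve_le_sum_curvature {D : Type} [Fintype D] [DecidableEq D] (M : Diagram D)
    (hne : [] ∉ M.faces) (hne' : M.faces ≠ []) : 12 ≤ 6 * (M.faces.length : ℤ) +
      (M.faces.flatten.map fun d => (cycleShare M.vert d : ℤ) +
        cycleShare (M.vert * M.face) d - 6).sum := by
  have hpl := M.planar
  rw [IsPlanar] at hpl
  have h1 := M.isFaceList.cycleCount_le hne
  have h2 : Nat.card {d // d ∉ M.faces.flatten} < componentCount M.face M.vert := by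
    obtain ⟨l, hl⟩ := List.exists_mem_of_ne_nil _ hne'
    obtain ⟨d, hd⟩ := List.exists_mem_of_ne_nil l fun h => hne (h ▸ hl)
    exact M.isFaceList.lt_componentCount (List.mem_flatten.2 ⟨l, hl, hd⟩)
  have h3 := six_mul_cycleCount_le M.vert
  have h4 := six_mul_cycleCount_le (M.vert * M.face)
  have h5 : ∑ d, ((cycleShare M.vert d : ℤ) + cycleShare (M.vert * M.face) d - 6) =
      (M.faces.flatten.map fun d => (cycleShare M.vert d : ℤ) +
        cycleShare (M.vert * M.face) d - 6).sum + 6 * Nat.card {d // d ∉ M.faces.flatten} := by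
    rw [← Finset.sum_filter_add_sum_filter_not Finset.univ (· ∈ M.faces.flatten)]
    congr 1
    · rw [← List.sum_toFinset _ M.isFaceList.nodup]
      refine Finset.sum_congr ?_ fun _ _ => rfl
      ext d
      simp
    · rw [Finset.sum_congr rfl (g := fun _ => (6 : ℤ)), Finset.sum_const, Nat.card_eq_fintype_card,
        Fintype.card_subtype, nsmul_eq_mul, mul_comm]
      intro d hd
      obtain ⟨h6, h7⟩ := M.isFaceList.fixed d (by simpa using hd)
      simp [cycleShare, h6, h7]
  rw [Finset.sum_sub_distrib, Finset.sum_add_distrib, Finset.sum_const, Finset.card_univ,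
    ← Nat.card_eq_fintype_card] at h5
  zify at *
  rw [nsmul_eq_mul] at h5
  linarith

/-- Exponents of subwords of the relators which determine their position. -/
def runs : List (List (ZMod 3)) :=
  [[1, 1, 1, 1], [2, 2, 2, 1, 1, 2, 2], [2, 1, 2, 2],
    [1, 1, 2, 1], [1, 1, 2, 2, 1, 1, 1], [2, 2, 2, 2]]

theorem mirror_mem_runs : ∀ r ∈ runs, mirror r ∈ runs := by decide

theorem cell_eq_flatten : ∀ c ∈ [relList, mirror relList],
    ∃ rs : List (List (ZMod 3)), (∀ r ∈ rs, r ∈ runs) ∧ rs.length = 6 ∧ c = rs.flatten := by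
  simp only [List.mem_cons, List.not_mem_nil, or_false, forall_eq_or_imp, forall_eq]
  exact ⟨⟨[[1, 1, 1, 1], [2, 2, 2, 1, 1, 2, 2], [2, 1, 2, 2],
    [1, 1, 1, 1], [2, 2, 2, 1, 1, 2, 2], [2, 1, 2, 2]], by decide, rfl, by decide⟩,
    ⟨[[1, 1, 2, 1], [1, 1, 2, 2, 1, 1, 1], [2, 2, 2, 2],
    [1, 1, 2, 1], [1, 1, 2, 2, 1, 1, 1], [2, 2, 2, 2]], by decide, rfl, by decide⟩⟩

theorem rotate_eq_mirror_of_run : ∀ r ∈ runs, ∀ c₁ ∈ [relList, mirror relList], ∀ n₁ < 30,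
    (c₁.rotate n₁).take r.length = r → ∀ c₂ ∈ [relList, mirror relList], ∀ n₂ < 30,
      (c₂.rotate n₂).take r.length = mirror r →
        (c₂.rotate n₂).rotate r.length = mirror (c₁.rotate n₁) := by
  decide +kernel

theorem rotate_ne_mirror_rotate : ∀ c ∈ [relList, mirror relList], ∀ n₁ < 30, ∀ n₂ < 30,
    c.rotate n₂ ≠ mirror (c.rotate n₁) := by
  decide +kernel

theorem ne_zero_of_mem_cell : ∀ c ∈ [relList, mirror relList], ∀ e ∈ c, e ≠ 0 := by decide +kernel

theorem length_cell : ∀ c ∈ [relList, mirror relList], c.length = 30 := by decide +kernel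
theorem length_run : ∀ r ∈ runs, 0 < r.length ∧ r.length < 30 := by decide +kernel

theorem isCell_iff {c : List (ZMod 2 × ZMod 3)} :
    IsCell c ↔ ∃ es ∈ [relList, mirror relList], c = signWord es := by
  simp [IsCell]

theorem signWord_map_snd (es : List (ZMod 3)) : (signWord es).map Prod.snd = es := by
  simp [signWord, Function.comp_def]

namespace Diagram
variable {D : Type} (M : Diagram D)

/-- The faces other than the first are relator cells, the first one is labelled by `w`,
and there are no cancelling pairs of cells. -/
structure IsReduced (w : List (ZMod 3)) (l₀ : List D) (ls : List (List D)) : Prop where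
  faces_eq : M.faces = l₀ :: ls
  map_outer : l₀.map M.lab = signWord w
  isCell : ∀ l ∈ ls, IsCell (l.map M.lab)
  not_mirror : ∀ l₁ ∈ ls, ∀ l₂ ∈ ls, ∀ p ∈ l₁, M.vert p ∈ l₂ → M.vert (M.vert p) = p →
    ∀ es, (List.iterate M.face p l₁.length).map M.lab = signWord es →
      (List.iterate M.face (M.vert p) l₂.length).map M.lab ≠ signWord (mirror es)

theorem cell_iterate {l : List D} (hl : l ∈ M.faces) (hc : IsCell (l.map M.lab)) {p : D}
    (hp : p ∈ l) : ∃ c ∈ [relList, mirror relList], l.map M.lab = signWord c ∧ l.length = 30 ∧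
      ∃ n < 30, l.rotate n = List.iterate M.face p 30 ∧
        (List.iterate M.face p 30).map M.lab = signWord (c.rotate n) := by
  obtain ⟨c, hc, h1⟩ := isCell_iff.1 hc
  have h2 : l.length = 30 := by
    rw [← length_cell c hc, ← List.length_map M.lab, h1, signWord, List.length_map]
  obtain ⟨n, hn, h3⟩ := IsFaceList.exists_rotate_eq (M.isFaceList.map_eq l hl) hp
  rw [h2] at h3 hn
  refine ⟨c, hc, h1, h2, n, hn, h3, ?_⟩
  rw [← h3, List.map_rotate, h1, signWord, signWord, List.map_rotate]

theorem exists_isReduced {w : List (ZMod 3)} (h : HasDiagram (signWord w)) :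
    ∃ (D : Type) (_ : Finite D) (M : Diagram D) (l₀ : List D) (ls : List (List D)),
      M.IsReduced w l₀ ls := by
  classical
  have h' : ∃ n, ∃ cs : List (List (ZMod 2 × ZMod 3)), cs.length = n ∧ (∀ c ∈ cs, IsCell c) ∧
    Realizable (signWord w :: cs) := let ⟨cs, h1, h2⟩ := h; ⟨_, cs, rfl, h1, h2⟩
  obtain ⟨cs, h1, h2, D, _, M, hM⟩ := Nat.find_spec h'
  have hmin := fun m hm => Nat.find_min h' (m := m) hm
  rw [← h1] at hmin
  obtain ⟨l₀, ls, hf, hw, rfl⟩ := List.map_eq_cons_iff.1 hM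
  have hcell : ∀ l ∈ ls, IsCell (l.map M.lab) := fun l hl => h2 _ (List.mem_map_of_mem hl)
  have hmem : ∀ l ∈ ls, l ∈ M.faces := fun l hl => hf ▸ List.mem_cons_of_mem _ hl
  refine ⟨D, inferInstance, M, l₀, ls, hf, hw, hcell, ?_⟩
  intro l₁ hl₁ l₂ hl₂ p hp hq hqp es hes hm
  by_cases hl : l₁ = l₂
  · subst hl
    obtain ⟨c, hc, h3, h4, n₁, hn₁, -, h5⟩ := M.cell_iterate (hmem _ hl₁) (hcell _ hl₁) hp
    obtain ⟨c', -, h3', -, n₂, hn₂, -, h5'⟩ := M.cell_iterate (hmem _ hl₁) (hcell _ hl₁) hq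
    obtain rfl : c = c' := by rw [← signWord_map_snd c, ← h3, h3', signWord_map_snd]
    rw [h4] at hes hm
    refine rotate_ne_mirror_rotate c hc n₁ hn₁ n₂ hn₂ ?_
    rw [← signWord_map_snd (c.rotate n₂), ← h5', hm, signWord_map_snd,
      ← signWord_map_snd (c.rotate n₁), ← h5, hes, signWord_map_snd]
  · have hp1 : ls.Perm (l₁ :: l₂ :: (ls.erase l₁).erase l₂) :=
      (List.perm_cons_erase hl₁).trans
        ((List.perm_cons_erase ((List.mem_erase_of_ne (Ne.symm hl)).2 hl₂)).cons _)
    have h3 := M.reduce (hf ▸ hp1.cons l₀) hp hq rfl hqp hes hm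
    rw [hw] at h3
    refine hmin _ ?_ ⟨_, rfl, ?_, h3⟩
    · have := hp1.length_eq
      simp only [List.length_map, List.length_cons] at this ⊢
      omega
    · intro c hc
      obtain ⟨l, hl, rfl⟩ := List.mem_map.1 hc
      exact hcell _ (List.mem_of_mem_erase (List.mem_of_mem_erase hl))

end Diagram

theorem List.iterate_isInfix_flatten {D : Type} {f : D → D} {l : List D} (h : l.map f = l.rotate 1)
    {q : D} (hq : q ∈ l) (m : ℕ) : ∃ k, List.iterate f q m <:+: (List.replicate k l).flatten := by
  obtain ⟨n, hn, hr⟩ : ∃ n, n < l.length ∧ l.rotate n = List.iterate f q l.length := by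
    obtain ⟨n, hn, rfl⟩ := List.mem_iff_getElem.1 hq
    exact ⟨n, hn, rotate_eq_iterate_of_map_eq h hn⟩
  have h1 (j : ℕ) : List.iterate f q (j * l.length) = (List.replicate j (l.rotate n)).flatten := by
    induction j with
    | zero => simp
    | succ j ih =>
      have h2 : f^[l.length] q = q := by
        obtain ⟨i, hi, rfl⟩ := List.mem_iff_getElem.1 hq
        have h3 := List.getElem_of_eq (map_iterate_of_map_eq h l.length) (i := i) (by simpa)
        simpa using h3
      rw [Nat.succ_mul, Nat.add_comm, List.iterate_add, h2, ih, ← hr, List.replicate_succ,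
        List.flatten_cons]
  have h2 (j : ℕ) : l.take n ++ (List.replicate j (l.rotate n)).flatten ++ l.drop n =
      (List.replicate (j + 1) l).flatten := by
    induction j with
    | zero => simp
    | succ j ih =>
      rw [List.replicate_succ (n := j + 1), List.flatten_cons, ← ih, List.replicate_succ,
        List.flatten_cons, List.rotate_eq_drop_append_take hn.le]
      simp only [← List.append_assoc, List.take_append_drop]
  refine ⟨m + 1, List.IsInfix.trans (l₂ := List.iterate f q (m * l.length)) ?_
    ⟨l.take n, l.drop n, by rw [h1, h2]⟩⟩
  have h3 : m ≤ m * l.length := Nat.le_mul_of_pos_right _ (by omega)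
  obtain ⟨j, hj⟩ := Nat.exists_eq_add_of_le h3
  rw [hj, List.iterate_add]
  exact (List.prefix_append _ _).isInfix

/-- Words whose powers contain none of the runs. -/
def AvoidsRuns (w : List (ZMod 3)) : Prop :=
  ∀ r ∈ runs, ∀ k, ¬ r <:+: (List.replicate k w).flatten

namespace Diagram
variable {D : Type} {M : Diagram D} {w : List (ZMod 3)} {l₀ : List D} {ls : List (List D)}

theorem map_snd_eq {s : List D} {es : List (ZMod 3)} (hs : s.map M.lab = signWord es) :
    s.map (fun d => (M.lab d).2) = es := by
  rw [← signWord_map_snd es, ← hs, List.map_map]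
  rfl

theorem mem_flatten_vert {d : D} (hd : d ∈ M.faces.flatten) : M.vert d ∈ M.faces.flatten := by
  by_contra h
  have h1 := (M.isFaceList.fixed _ h).2
  rw [M.vert.injective h1] at h
  exact h hd

theorem mem_flatten_face {d : D} (hd : d ∈ M.faces.flatten) : M.face d ∈ M.faces.flatten := by
  by_contra h
  have h1 := (M.isFaceList.fixed _ h).1
  rw [M.face.injective h1] at h
  exact h hd

theorem hol_vert_face (d : D) : M.hol (M.vert (M.face d)) * symX (M.lab (M.vert (M.face d))).1 =
    M.hol d * symX (M.lab d).1 * symY (M.lab d).2 := by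
  rw [M.hol_vert, M.hol_face]

theorem lab_vert_face {d : D} (h : M.vert (M.face (M.vert (M.face d))) = d) :
    (M.lab (M.vert (M.face d))).2 = -(M.lab d).2 := by
  have h1 := M.hol_vert_face (M.vert (M.face d))
  rw [h, M.hol_vert_face d, mul_assoc _ (symY _), ← symY_add] at h1
  exact (neg_eq_of_add_eq_zero_right (symY_eq_one _ (mul_eq_left.1 h1.symm))).symm

theorem snd_eq_zero_of_vert_face {d : D} (h : M.vert (M.face d) = d) : (M.lab d).2 = 0 := by
  have h1 := M.hol_vert_face d
  rw [h] at h1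
  exact symY_eq_one _ (mul_eq_left.1 h1.symm)

theorem fst_eq_zero_of_vert {d : D} (h : M.vert d = d) : (M.lab d).1 = 0 := by
  have h1 := M.hol_vert d
  rw [h] at h1
  exact symX_eq_one _ (mul_eq_left.1 h1)

/-- Six times the combinatorial curvature at a dart. -/
def curvature [DecidableEq D] (M : Diagram D) (d : D) : ℤ :=
  (cycleShare M.vert d : ℤ) + cycleShare (M.vert * M.face) d - 6

namespace IsReduced

theorem lab_mem_flatten (h : M.IsReduced w l₀ ls) (hw : ∀ e ∈ w, e ≠ 0) {d : D}
    (hd : d ∈ M.faces.flatten) : (M.lab d).1 = 1 ∧ (M.lab d).2 ≠ 0 := by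
  obtain ⟨l, hl, hdl⟩ := List.mem_flatten.1 hd
  have key : ∀ es : List (ZMod 3), (∀ e ∈ es, e ≠ 0) → l.map M.lab = signWord es →
      (M.lab d).1 = 1 ∧ (M.lab d).2 ≠ 0 := by
    intro es hes hl
    have := List.mem_map_of_mem (f := M.lab) hdl
    rw [hl, signWord, List.mem_map] at this
    obtain ⟨e, he, h1⟩ := this
    rw [← h1]
    exact ⟨rfl, hes e he⟩
  rw [h.faces_eq, List.mem_cons] at hl
  rcases hl with rfl | hl
  · exact key w hw h.map_outer
  · obtain ⟨c, hc, h1⟩ := isCell_iff.1 (h.isCell l hl)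
    exact key c (ne_zero_of_mem_cell c hc) h1

/-- A run in a cell has a corner of degree at least three. -/
theorem exists_mem_run (h : M.IsReduced w l₀ ls) (hav : AvoidsRuns w)
    {l A b B : List D} (hl : l ∈ ls) (hlb : l = A ++ b ++ B) {r : List (ZMod 3)} (hr : r ∈ runs)
    (hbr : b.map M.lab = signWord r) :
    ∃ d ∈ b, ¬ (M.vert (M.vert d) = d ∧ M.vert (M.face (M.vert (M.face d))) = d) := by
  by_contra! hgood
  have hl' : l ∈ M.faces := h.faces_eq ▸ List.mem_cons_of_mem _ hl
  have hlen : b.length = r.length := by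
    rw [← List.length_map M.lab, hbr, signWord, List.length_map]
  obtain ⟨hpos, hlt⟩ := length_run r hr
  obtain ⟨p, b', rfl⟩ := List.exists_cons_of_length_pos (hlen ▸ hpos)
  have hp : p ∈ l := by simp [hlb]
  have hAl : A.length < l.length := by simp [hlb]
  have hb : p :: b' = List.iterate M.face p r.length := by
    have h1 := List.rotate_eq_iterate_of_map_eq (M.isFaceList.map_eq l hl') hAl
    have h2 : l[A.length] = p := by simp [hlb]
    have h3 : r.length ≤ l.length := by
      rw [← hlen, hlb]; simp; omega
    rw [h2, ← Nat.add_sub_cancel' h3, List.iterate_add, List.rotate_eq_drop_append_take hAl.le] at h1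
    refine (List.append_inj (t₁ := B ++ A) (Eq.trans ?_ h1) (by simp [← hlen])).1
    simp [hlb]
  rw [hb] at hgood hbr
  have hgood' : ∀ t < r.length, M.vert (M.vert (M.face^[t] p)) = M.face^[t] p ∧
      M.vert (M.face (M.vert (M.face (M.face^[t] p)))) = M.face^[t] p :=
    fun t ht => hgood _ (List.mem_iterate.2 ⟨t, ht, rfl⟩)
  have hpf : p ∈ M.faces.flatten := List.mem_flatten.2 ⟨l, hl', hp⟩
  have hact (t : ℕ) {d : D} (hd : d ∈ M.faces.flatten) : M.face^[t] d ∈ M.faces.flatten := by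
    induction t with
    | zero => exact hd
    | succ t ih => rw [Function.iterate_succ_apply']; exact mem_flatten_face ih
  let q := M.vert (M.face^[r.length] p)
  have hqf : q ∈ M.faces.flatten := mem_flatten_vert (hact _ hpf)
  have hq : ∀ t ≤ r.length, M.face^[t] q = M.vert (M.face^[r.length - t] p) := by
    intro t
    induction t with
    | zero => intro _; rfl
    | succ t ih =>
      intro ht
      obtain ⟨h1, h2⟩ := hgood' (r.length - (t + 1)) (by omega)
      rw [Function.iterate_succ_apply', ih (by omega),
        show r.length - t = (r.length - (t + 1)) + 1 by omega, Function.iterate_succ_apply']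
      exact M.vert.injective (h2.trans h1.symm)
  have hqm : M.face^[r.length] q = M.vert p := by simpa using hq _ le_rfl
  have hpr : (List.iterate M.face p r.length).map (fun d => (M.lab d).2) = r :=
    map_snd_eq hbr
  have hqr : (List.iterate M.face q r.length).map (fun d => (M.lab d).2) = mirror r := by
    conv_rhs => rw [← hpr, mirror, List.map_map, ← List.map_reverse]
    refine List.ext_getElem (by simp) fun t h1 h2 => ?_
    simp only [List.length_map, List.length_iterate] at h1
    simp only [List.getElem_map, List.getElem_iterate, List.getElem_reverse, List.length_iterate,
      Function.comp_apply]
    rw [hq t h1.le, show r.length - t = (r.length - 1 - t) + 1 by omega, Function.iterate_succ_apply']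
    exact lab_vert_face (hgood' _ (by omega)).2
  obtain ⟨l₂, hl₂, hql₂⟩ := List.mem_flatten.1 hqf
  have hl₂' := hl₂
  rw [h.faces_eq, List.mem_cons] at hl₂
  rcases hl₂ with rfl | hl₂
  · obtain ⟨k, hk⟩ := List.iterate_isInfix_flatten (M.isFaceList.map_eq l₂ hl₂') hql₂ r.length
    have h1 := hk.map fun d => (M.lab d).2
    rw [hqr, List.map_flatten, List.map_replicate] at h1
    rw [map_snd_eq h.map_outer] at h1
    exact hav _ (mirror_mem_runs r hr) k h1
  · obtain ⟨c₁, hc₁, -, h30₁, n₁, hn₁, hr₁, h₁⟩ := M.cell_iterate hl' (h.isCell l hl) hp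
    obtain ⟨c₂, hc₂, -, h30₂, n₂, hn₂, hr₂, h₂⟩ := M.cell_iterate hl₂' (h.isCell l₂ hl₂) hql₂
    have htake (d : D) : (List.iterate M.face d 30).take r.length = List.iterate M.face d r.length := by
      rw [List.take_iterate, min_eq_left (by omega)]
    have hrot := rotate_eq_mirror_of_run r hr c₁ hc₁ n₁ hn₁
      (by rw [← map_snd_eq h₁, ← List.map_take, htake, hpr]) c₂ hc₂ n₂ hn₂
      (by rw [← map_snd_eq h₂, ← List.map_take, htake, hqr])
    have hvq : List.iterate M.face (M.vert p) 30 = (List.iterate M.face q 30).rotate r.length := by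
      have h1 : (List.iterate M.face q 30).map M.face = (List.iterate M.face q 30).rotate 1 := by
        rw [← hr₂, List.map_rotate, M.isFaceList.map_eq l₂ hl₂', List.rotate_rotate,
          List.rotate_rotate, Nat.add_comm]
      have h2 := List.rotate_eq_iterate_of_map_eq h1 (n := r.length) (by simpa using hlt)
      rw [h2, List.getElem_iterate, hqm, List.length_iterate]
    have hvp : M.vert p ∈ l₂ := by
      have h1 : M.vert p ∈ List.iterate M.face (M.vert p) 30 := List.mem_iterate.2 ⟨0, by simp⟩
      rwa [hvq, ← hr₂, List.mem_rotate, List.mem_rotate] at h1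
    refine h.not_mirror l hl l₂ hl₂ p hp hvp (hgood' 0 hpos).1 (c₁.rotate n₁) (h30₁ ▸ h₁) ?_
    rw [h30₂, hvq, List.map_rotate, h₂, ← hrot]
    simp [signWord, List.map_rotate]

section Curvature
variable [DecidableEq D]

theorem curvature_le (h : M.IsReduced w l₀ ls) (hw : ∀ e ∈ w, e ≠ 0) {d : D}
    (hd : d ∈ M.faces.flatten) : M.curvature d ≤
      if M.vert (M.vert d) = d ∧ M.vert (M.face (M.vert (M.face d))) = d then 0 else -1 := by
  obtain ⟨h1, h2⟩ := h.lab_mem_flatten hw hd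
  have h3 : M.vert d ≠ d := fun h4 => by simp [fst_eq_zero_of_vert h4] at h1
  have h4 : (M.vert * M.face) d ≠ d := fun h5 => h2 (snd_eq_zero_of_vert_face h5)
  rw [curvature, cycleShare, if_neg h3, cycleShare, if_neg h4]
  simp only [Perm.mul_apply]
  split_ifs <;> simp_all

theorem sum_curvature_nonpos (h : M.IsReduced w l₀ ls) (hw : ∀ e ∈ w, e ≠ 0) {l : List D}
    (hl : ∀ d ∈ l, d ∈ M.faces.flatten) : (l.map M.curvature).sum ≤ 0 := by
  refine (List.sum_le_card_nsmul _ 0 fun c hc => ?_).trans_eq (nsmul_zero _)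
  obtain ⟨d, hd, rfl⟩ := List.mem_map.1 hc
  refine (h.curvature_le hw (hl d hd)).trans ?_
  split_ifs <;> decide

theorem sum_curvature_run (h : M.IsReduced w l₀ ls) (hw : ∀ e ∈ w, e ≠ 0) (hav : AvoidsRuns w)
    {l A b B : List D} (hl : l ∈ ls) (hlb : l = A ++ b ++ B) {r : List (ZMod 3)} (hr : r ∈ runs)
    (hbr : b.map M.lab = signWord r) : (b.map M.curvature).sum ≤ -1 := by
  obtain ⟨d, hd, hbad⟩ := h.exists_mem_run hav hl hlb hr hbr
  have hb : ∀ d ∈ b, d ∈ M.faces.flatten := fun d hd =>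
    List.mem_flatten.2 ⟨l, h.faces_eq ▸ List.mem_cons_of_mem _ hl, by simp [hlb, hd]⟩
  obtain ⟨s, t, rfl⟩ := List.append_of_mem hd
  have h1 := h.curvature_le hw (hb d hd)
  rw [if_neg hbad] at h1
  have h2 := h.sum_curvature_nonpos hw (l := s) fun d hd => hb d (by simp [hd])
  have h3 := h.sum_curvature_nonpos hw (l := t) fun d hd => hb d (by simp [hd])
  rw [List.map_append, List.map_cons, List.sum_append, List.sum_cons]
  linarith

theorem sum_curvature_runs (h : M.IsReduced w l₀ ls) (hw : ∀ e ∈ w, e ≠ 0) (hav : AvoidsRuns w)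
    {l : List D} (hl : l ∈ ls) {rs : List (List (ZMod 3))} (hrs : ∀ r ∈ rs, r ∈ runs)
    {A B : List D} (hlb : l = A ++ B) (hB : B.map M.lab = signWord rs.flatten) :
    (B.map M.curvature).sum ≤ -rs.length := by
  induction rs generalizing A B with
  | nil =>
    obtain rfl : B = [] := by simpa [signWord] using hB
    simp
  | cons r rs ih =>
    rw [List.flatten_cons, signWord, List.map_append] at hB
    obtain ⟨b, B, rfl, h1, h2⟩ := List.map_eq_append_iff.1 hB
    rw [← List.append_assoc] at hlb
    have h3 := ih (fun r hr => hrs r (List.mem_cons_of_mem _ hr)) hlb h2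
    have h4 := h.sum_curvature_run hw hav hl hlb (hrs r List.mem_cons_self) h1
    rw [List.map_append, List.sum_append, List.length_cons]
    push_cast
    linarith

theorem sum_curvature_cells (h : M.IsReduced w l₀ ls) (hw : ∀ e ∈ w, e ≠ 0) (hav : AvoidsRuns w)
    {Ls : List (List D)} (hLs : ∀ l ∈ Ls, l ∈ ls) :
    (Ls.flatten.map M.curvature).sum ≤ -(6 * Ls.length) := by
  induction Ls with
  | nil => simp
  | cons l Ls ih =>
    have hl := hLs l List.mem_cons_self
    obtain ⟨c, hc, h1⟩ := isCell_iff.1 (h.isCell l hl)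
    obtain ⟨rs, hrs, hlen, rfl⟩ := cell_eq_flatten c hc
    have h2 := h.sum_curvature_runs hw hav hl hrs (A := []) rfl h1
    have h3 := ih fun l hl => hLs l (List.mem_cons_of_mem _ hl)
    rw [List.flatten_cons, List.map_append, List.sum_append, List.length_cons]
    rw [hlen] at h2
    push_cast at h2 ⊢
    linarith

end Curvature

end IsReduced
end Diagram

/-- Words which avoid the runs do not bound diagrams. -/
theorem not_hasDiagram {w : List (ZMod 3)} (hne : w ≠ []) (hw : ∀ e ∈ w, e ≠ 0)
    (hav : AvoidsRuns w) : ¬ HasDiagram (signWord w) := by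
  classical
  intro hd
  obtain ⟨D, _, M, l₀, ls, h⟩ := Diagram.exists_isReduced hd
  have := Fintype.ofFinite D
  have h1 : [] ∉ M.faces := by
    rw [h.faces_eq, List.mem_cons, not_or]
    constructor
    · rintro rfl
      exact hne (by simpa [signWord] using h.map_outer.symm)
    · intro h2
      obtain ⟨c, hc, h3⟩ := isCell_iff.1 (h.isCell _ h2)
      have h4 := length_cell c hc
      simp [signWord] at h3
      simp [h3] at h4
  have h2 := M.twelve_le_sum_curvature h1 (by simp [h.faces_eq])
  change _ ≤ _ + (M.faces.flatten.map M.curvature).sum at h2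
  have h3 := h.sum_curvature_cells hw hav (Ls := ls) fun _ => id
  have h4 := h.sum_curvature_nonpos hw (l := l₀) fun d hd =>
    List.mem_flatten.2 ⟨l₀, by simp [h.faces_eq], hd⟩
  rw [h.faces_eq, List.flatten_cons, List.map_append, List.sum_append, List.length_cons] at h2
  push_cast at h2
  linarith

theorem mk_signElt_ne_one {w : List (ZMod 3)} (hne : w ≠ []) (hw : ∀ e ∈ w, e ≠ 0)
    (hav : AvoidsRuns w) : mk W22 (signElt w) ≠ 1 :=
  fun h => not_hasDiagram hne hw hav (hasDiagram_of_mk_eq_one h)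

/-- A word in the signs whose concatenations avoid all the runs. -/
def block (e : ZMod 3) : List (ZMod 3) := [2, 2, 1, 2, 1, 1, e]

theorem not_isInfix_flatMap_block {r : List (ZMod 3)} (hr : r ∈ runs) :
    ∀ {es : List (ZMod 3)}, (∀ e ∈ es, e ≠ 0) → ¬ r <:+: es.flatMap block
  | [], _ => by
    simp only [runs, List.mem_cons, List.not_mem_nil, or_false] at hr
    rcases hr with rfl | rfl | rfl | rfl | rfl | rfl <;> simp
  | e :: es, h => by
    have ih := not_isInfix_flatMap_block hr (es := es) fun e he => h e (by simp [he])
    have he : e = 1 ∨ e = 2 := by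
      have := h e (by simp)
      revert this
      clear h
      revert e
      decide
    have h2 : (2 : ZMod 3) ≠ 1 := by decide
    simp only [runs, List.mem_cons, List.not_mem_nil, or_false] at hr
    cases es with
    | nil =>
      rcases hr with rfl | rfl | rfl | rfl | rfl | rfl <;> rcases he with rfl | rfl <;>
        simp [block, List.infix_cons_iff, List.cons_prefix_cons, h2, h2.symm]
    | cons e' es =>
      rw [List.flatMap_cons] at ih ⊢
      rcases hr with rfl | rfl | rfl | rfl | rfl | rfl <;> rcases he with rfl | rfl <;>
        simp [block, List.infix_cons_iff, List.cons_prefix_cons, h2, h2.symm] at ih ⊢ <;> tauto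

theorem avoidsRuns_flatMap_block {es : List (ZMod 3)} (h : ∀ e ∈ es, e ≠ 0) :
    AvoidsRuns (es.flatMap block) := by
  intro r hr k
  have : (List.replicate k (es.flatMap block)).flatten =
      (List.replicate k es).flatten.flatMap block := by
    induction k with
    | zero => simp
    | succ k ih => simp [List.replicate_succ, ih]
  rw [this]
  refine not_isInfix_flatMap_block hr fun e he => ?_
  obtain ⟨l, hl, hel⟩ := List.mem_flatten.mp he
  exact h e (List.eq_of_mem_replicate hl ▸ hel)

theorem mk_signElt_flatMap_block_ne_one {es : List (ZMod 3)} (hne : es ≠ [])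
    (h : ∀ e ∈ es, e ≠ 0) : mk W22 (signElt (es.flatMap block)) ≠ 1 := by
  refine mk_signElt_ne_one ?_ ?_ (avoidsRuns_flatMap_block h)
  · cases es <;> simp_all [block]
  · intro e he
    obtain ⟨d, hd, he⟩ := List.mem_flatMap.mp he
    simp only [block, List.mem_cons, List.not_mem_nil, or_false] at he
    rcases he with rfl | rfl | rfl | rfl | rfl | rfl | rfl
    iterate 6 decide
    exact h _ hd

section FreeSubgroup

variable {G : Type*} [Group G] (Z Y : G)

/-- The product of the elements `Z * Y ^ e` over the signs `e` of a list. -/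
def alternating (es : List (ZMod 3)) : G := (es.map fun e => Z * Y ^ e.val).prod

/-- The elements `(Z * Y) ^ 2` and `(Z * Y ^ 2) ^ 2`. -/
def squares (i : Fin 2) : G := (Z * Y ^ (![1, 2] i : ZMod 3).val) ^ 2

/-- The left half of the value of a letter under the map given by `squares`. -/
def leftHalf (s : Fin 2 × Bool) : G :=
  bif s.2 then Z * Y ^ (![1, 2] s.1 : ZMod 3).val else Y ^ (-![1, 2] s.1 : ZMod 3).val

/-- The right half of the value of a letter under the map given by `squares`. -/
def rightHalf (s : Fin 2 × Bool) : G :=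
  bif s.2 then Z * Y ^ (![1, 2] s.1 : ZMod 3).val else Z * Y ^ (-![1, 2] s.1 : ZMod 3).val * Z

/-- The signs describing the right half of a letter times the left half of the next one. -/
def junction (s t : Fin 2 × Bool) : List (ZMod 3) :=
  bif s.2 then
    bif t.2 then [![1, 2] s.1, ![1, 2] t.1] else [![1, 2] s.1 - ![1, 2] t.1]
  else
    bif t.2 then [-![1, 2] s.1 + ![1, 2] t.1] else [-![1, 2] s.1, -![1, 2] t.1]

theorem junction_ne_nil : ∀ s t, junction s t ≠ [] := by decide

theorem ne_zero_of_mem_junction : ∀ s t, (s.1 = t.1 → s.2 = t.2) → ∀ e ∈ junction s t, e ≠ 0 := by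
  decide

variable {Z Y}

theorem alternating_append (es fs : List (ZMod 3)) :
    alternating Z Y (es ++ fs) = alternating Z Y es * alternating Z Y fs := by
  simp [alternating]

theorem pow_val_add (hY : Y ^ 3 = 1) (a b : ZMod 3) :
    Y ^ (a + b).val = Y ^ a.val * Y ^ b.val := by
  rw [ZMod.val_add, ← pow_add, ← pow_eq_pow_mod _ hY]

theorem rightHalf_mul_leftHalf (hZ : Z * Z = 1) (hY : Y ^ 3 = 1) (s t : Fin 2 × Bool) :
    rightHalf Z Y s * leftHalf Z Y t = alternating Z Y (junction s t) := by
  obtain ⟨i, _ | _⟩ := s <;> obtain ⟨j, _ | _⟩ := t <;>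
    simp only [rightHalf, leftHalf, junction, alternating, cond_true, cond_false, List.map_cons,
      List.map_nil, List.prod_cons, List.prod_nil, mul_one, sub_eq_add_neg, pow_val_add hY]
  · simp only [mul_assoc]
  · simp only [mul_assoc]
    rw [← mul_assoc Z Z, hZ, one_mul]
  · simp only [mul_assoc]

theorem lift_squares_mk (hZ : Z * Z = 1) (hY : Y ^ 3 = 1) (L : List (Fin 2 × Bool)) :
    FreeGroup.lift (squares Z Y) (FreeGroup.mk L) =
      (L.map fun s => leftHalf Z Y s * rightHalf Z Y s).prod := by
  rw [FreeGroup.lift_mk]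
  congr 1
  refine List.map_congr_left fun s _ => ?_
  obtain ⟨i, _ | _⟩ := s
  · have h : Y ^ (-![1, 2] i : ZMod 3).val = (Y ^ (![1, 2] i : ZMod 3).val)⁻¹ := by
      rw [eq_inv_iff_mul_eq_one, ← pow_val_add hY, neg_add_cancel, ZMod.val_zero, pow_zero]
    simp [leftHalf, rightHalf, squares, h, pow_two, inv_eq_of_mul_eq_one_right hZ, mul_assoc]
  · simp [leftHalf, rightHalf, squares, pow_two]

theorem exists_prod_eq_alternating (hZ : Z * Z = 1) (hY : Y ^ 3 = 1) (s : Fin 2 × Bool)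
    (L : List (Fin 2 × Bool)) (h : FreeGroup.IsReduced (s :: L)) :
    ∃ es, (∀ e ∈ es, e ≠ 0) ∧
      ((s :: L).map fun s => leftHalf Z Y s * rightHalf Z Y s).prod =
        leftHalf Z Y s * alternating Z Y es * rightHalf Z Y ((s :: L).getLast (by simp)) := by
  induction L generalizing s with
  | nil => exact ⟨[], by simp, by simp [alternating]⟩
  | cons t L ih =>
    have h' := List.isChain_cons_cons.mp h
    obtain ⟨es, hes, heq⟩ := ih t h'.2
    refine ⟨junction s t ++ es, ?_, ?_⟩
    · intro e he
      rcases List.mem_append.mp he with he | he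
      exacts [ne_zero_of_mem_junction s t h'.1 e he, hes e he]
    · rw [List.map_cons, List.prod_cons, heq, List.getLast_cons (List.cons_ne_nil t L),
        alternating_append, ← rightHalf_mul_leftHalf hZ hY]
      simp only [mul_assoc]

theorem injective_lift_squares (hZ : Z * Z = 1) (hY : Y ^ 3 = 1)
    (hne : ∀ es : List (ZMod 3), es ≠ [] → (∀ e ∈ es, e ≠ 0) → alternating Z Y es ≠ 1) :
    Function.Injective (FreeGroup.lift (squares Z Y)) := by
  refine (injective_iff_map_eq_one _).mpr fun g hg => ?_
  have hred := FreeGroup.reduceCyclically.isCyclicallyReduced (FreeGroup.isReduced_toWord (x := g))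
  have hconj := FreeGroup.reduceCyclically.conj_conjugator_reduceCyclically g.toWord
  have hmk : g = FreeGroup.mk (FreeGroup.reduceCyclically.conjugator g.toWord) *
      FreeGroup.mk (FreeGroup.reduceCyclically g.toWord) *
      (FreeGroup.mk (FreeGroup.reduceCyclically.conjugator g.toWord))⁻¹ := by
    rw [FreeGroup.inv_mk, FreeGroup.mul_mk, FreeGroup.mul_mk, hconj, FreeGroup.mk_toWord]
  rw [hmk, map_mul, map_mul, map_inv, conj_eq_one_iff, lift_squares_mk hZ hY] at hg
  rw [hmk, conj_eq_one_iff]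
  generalize FreeGroup.reduceCyclically g.toWord = L at hred hg
  match L with
  | [] => rfl
  | s :: L =>
    obtain ⟨es, hes, heq⟩ := exists_prod_eq_alternating (Z := Z) (Y := Y) hZ hY s L hred.1
    have hlast := hred.2 _ (List.getLast?_eq_some_getLast (by simp)) s rfl
    set t := (s :: L).getLast (by simp)
    refine absurd ?_ (hne (es ++ junction t s) (by simp [junction_ne_nil]) ?_)
    · rw [alternating_append, ← rightHalf_mul_leftHalf hZ hY, ← mul_assoc,
        mul_eq_one_comm, ← mul_assoc, ← heq, hg]
    · intro e he
      rcases List.mem_append.mp he with he | he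
      exacts [hes e he, ne_zero_of_mem_junction _ _ hlast e he]

end FreeSubgroup

theorem mk_rel {r : F} (hr : r ∈ rels W22) : mk W22 r = 1 :=
  PresentedGroup.one_of_mem hr

theorem mk_signElt_flatMap_block (es : List (ZMod 3)) :
    mk W22 (signElt (es.flatMap block)) =
      alternating (mk W22 (signElt [2, 2, 1, 2, 1, 1] * x)) (mk W22 y) es := by
  induction es with
  | nil => simp [signElt, alternating]
  | cons e es ih =>
    have h : signElt ((e :: es).flatMap block) =
        signElt [2, 2, 1, 2, 1, 1] * x * y ^ e.val * signElt (es.flatMap block) := by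
      simp [signElt, block, mul_assoc]
    rw [h, map_mul, ih]
    simp [alternating]

theorem mk_y_pow_three : mk W22 y ^ 3 = 1 := by
  rw [← map_pow]
  exact mk_rel (by simp [rels])

theorem mk_blockPrefix_mul_self : mk W22 (signElt [2, 2, 1, 2, 1, 1] * x) *
    mk W22 (signElt [2, 2, 1, 2, 1, 1] * x) = 1 := by
  have hx : mk W22 x * mk W22 x = 1 := by
    rw [← map_mul, ← pow_two]
    exact mk_rel (by simp [rels])
  have hy : mk W22 y ^ 3 = 1 := mk_y_pow_three
  have hx' (g) : mk W22 x * (mk W22 x * g) = g := by rw [← mul_assoc, hx, one_mul]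
  have hy' (g) : mk W22 y * (mk W22 y * (mk W22 y * g)) = g := by
    rw [← mul_assoc, ← mul_assoc, ← pow_three', hy, one_mul]
  have h2 : (2 : ZMod 3).val = 2 := rfl
  have h1 : (1 : ZMod 3).val = 1 := rfl
  simp [signElt, h1, h2, pow_two, mul_assoc, hx, hx', hy']

/-- The free group of rank two embeds into the group. -/
theorem exists_injective : ∃ f : FreeGroup (Fin 2) →* GT W22, Function.Injective f :=
  ⟨_, injective_lift_squares mk_blockPrefix_mul_self mk_y_pow_three fun es hne h => by
    rw [← mk_signElt_flatMap_block]
    exact mk_signElt_flatMap_block_ne_one hne h⟩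

end

theorem stmt_19 :
    ∃ H : Subgroup (GT W22), Nonempty (H ≃* FreeGroup (Fin 2)) := by
  obtain ⟨f, hf⟩ := exists_injective
  exact ⟨f.range, ⟨(MonoidHom.ofInjective hf).symm⟩⟩
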